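/- arXiv:math/0507172 — 2 statements merged into one kernel-verified Lean document; each statement's English description precedes it below -/
import Mathlib

section
/- The deterministic system of N+n equations ψ_i(z) = −1/(z(1 + (1/n)Tr(D̃_i T̃(z)))) for 1 ≤ i ≤ N and ψ̃_j(z) = −1/(z(1 + (1/n)Tr(D_j T(z)))) for 1 ≤ j ≤ n admits a unique solution (ψ_1,…,ψ_N, ψ̃_1,…,ψ̃_n) in S(ℝ+)^{N+n}. Moreover, there exist a positive N×N matrix-valued measure μ and a positive n×n matrix-valued measure μ̃ with μ(ℝ+) = I_N and μ̃(ℝ+) = I_n such that T(z) = ∫_{[0,∞)} (λ − z)⁻¹ μ(dλ) and T̃(z) = ∫_{[0,∞)} (λ − z)⁻¹ μ̃(dλ) for all z ∈ ℂ ∖ ℝ+; in particular (1/N)Tr T(z) and (1/n)Tr T̃(z) are Stieltjes transforms of probability measures on ℝ+. -/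
open MeasureTheory Matrix Complex Filter
open scoped Topology ComplexOrder

noncomputable section

/-- The set `ℂ ∖ ℝ₊`. -/
def offRplus : Set ℂ := {z : ℂ | ¬ (z.im = 0 ∧ 0 ≤ z.re)}

/-- `f` is the Stieltjes transform of a probability measure carried by `ℝ₊`. -/
def IsStieltjesPM (f : ℂ → ℂ) : Prop :=
  ∃ μ : Measure ℝ, IsProbabilityMeasure μ ∧ μ (Set.Iio 0) = 0 ∧
    ∀ z ∈ offRplus, f z = ∫ t, ((t : ℂ) - z)⁻¹ ∂μ
def Tmat {N n : ℕ} (A : Matrix (Fin N) (Fin n) ℝ)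
    (ψ : Fin N → ℂ → ℂ) (ψt : Fin n → ℂ → ℂ) (z : ℂ) : Matrix (Fin N) (Fin N) ℂ :=
  ((Matrix.diagonal fun i => ψ i z)⁻¹
    - z • (A.map Complex.ofReal * Matrix.diagonal (fun j => ψt j z) * (A.map Complex.ofReal)ᵀ))⁻¹

def Ttmat {N n : ℕ} (A : Matrix (Fin N) (Fin n) ℝ)
    (ψ : Fin N → ℂ → ℂ) (ψt : Fin n → ℂ → ℂ) (z : ℂ) : Matrix (Fin n) (Fin n) ℂ :=
  ((Matrix.diagonal fun j => ψt j z)⁻¹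
    - z • ((A.map Complex.ofReal)ᵀ * Matrix.diagonal (fun i => ψ i z) * A.map Complex.ofReal))⁻¹

def SolvesSystem {N n : ℕ} (σ : Fin N → Fin n → ℝ) (A : Matrix (Fin N) (Fin n) ℝ)
    (ψ : Fin N → ℂ → ℂ) (ψt : Fin n → ℂ → ℂ) : Prop :=
  (∀ i, IsStieltjesPM (ψ i)) ∧ (∀ j, IsStieltjesPM (ψt j)) ∧
  ∀ z ∈ offRplus,
    (∀ i, ψ i z
      = -(z * (1 + (n : ℂ)⁻¹
          * ((Matrix.diagonal fun j => ((σ i j : ℂ))^2) * Ttmat A ψ ψt z).trace))⁻¹) ∧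
    (∀ j, ψt j z
      = -(z * (1 + (n : ℂ)⁻¹
          * ((Matrix.diagonal fun i => ((σ i j : ℂ))^2) * Tmat A ψ ψt z).trace))⁻¹)

def HasUnitMatrixMeasureRep (d : ℕ) (F : ℂ → Matrix (Fin d) (Fin d) ℂ) : Prop :=
  ∃ (τ : Measure ℝ) (ρ : ℝ → Matrix (Fin d) (Fin d) ℂ),
    τ (Set.Iio 0) = 0 ∧
    (∀ i j, Measurable fun t : ℝ => ρ t i j) ∧
    (∀ᵐ t ∂τ, (ρ t).PosSemidef) ∧
    (∀ i j, Integrable (fun t : ℝ => ρ t i j) τ) ∧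
    (Matrix.of fun i j => ∫ t, ρ t i j ∂τ) = (1 : Matrix (Fin d) (Fin d) ℂ) ∧
    ∀ z ∈ offRplus,
      (∀ i j, Integrable (fun t : ℝ => ((t : ℂ) - z)⁻¹ * ρ t i j) τ) ∧
      F z = Matrix.of fun i j => ∫ t, ((t : ℂ) - z)⁻¹ * ρ t i j ∂τ

section LinAlg
variable {m : Type} [Fintype m] [DecidableEq m]

lemma quad_bound (H : Matrix m m ℂ) (hH : H.IsHermitian) (d : m → ℂ) (s y : ℝ) (hs : |s| = 1)
    (hd : ∀ a, y ≤ s * (d a).im) (v u : m → ℂ) (h : (H + diagonal d) *ᵥ v = u) :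
    y * ∑ a, ‖v a‖ ^ 2 ≤ ‖∑ a, (starRingEnd ℂ) (v a) * u a‖ := by
  have h1 : (star v ⬝ᵥ (H *ᵥ v)).im = 0 := hH.im_star_dotProduct_mulVec_self v
  have h2 : (star v ⬝ᵥ u) = star v ⬝ᵥ (H *ᵥ v) + ∑ a, d a * ((‖v a‖ ^ 2 : ℝ) : ℂ) := by
    rw [← h, add_mulVec, dotProduct_add]
    congr 1
    simp only [dotProduct, mulVec_diagonal, Pi.star_apply, RCLike.star_def]
    refine Finset.sum_congr rfl fun a _ => ?_
    rw [← Complex.normSq_eq_norm_sq, Complex.normSq_eq_conj_mul_self]; ring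
  have h3 : s * (star v ⬝ᵥ u).im = ∑ a, s * (d a).im * ‖v a‖ ^ 2 := by
    rw [h2, Complex.add_im, h1, zero_add, Complex.im_sum, Finset.mul_sum]
    refine Finset.sum_congr rfl fun a _ => ?_
    rw [Complex.im_mul_ofReal]; ring
  have h4 : y * ∑ a, ‖v a‖ ^ 2 ≤ s * (star v ⬝ᵥ u).im := by
    rw [h3, Finset.mul_sum]
    exact Finset.sum_le_sum fun a _ => mul_le_mul_of_nonneg_right (hd a) (by positivity)
  calc _ ≤ _ := h4
    _ ≤ |s * (star v ⬝ᵥ u).im| := le_abs_self _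
    _ = |(star v ⬝ᵥ u).im| := by rw [abs_mul, hs, one_mul]
    _ ≤ ‖star v ⬝ᵥ u‖ := Complex.abs_im_le_norm _
    _ = _ := rfl

lemma isUnit_herm (H : Matrix m m ℂ) (hH : H.IsHermitian) (d : m → ℂ) (s y : ℝ) (hs : |s| = 1)
    (hy : 0 < y) (hd : ∀ a, y ≤ s * (d a).im) : IsUnit (H + diagonal d) := by
  rw [← Matrix.mulVec_injective_iff_isUnit]
  intro v v' hvv
  have h0 : (H + diagonal d) *ᵥ (v - v') = 0 := by rw [mulVec_sub]; exact sub_eq_zero.2 hvv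
  have := quad_bound H hH d s y hs hd _ _ h0
  simp only [Pi.zero_apply, mul_zero, Finset.sum_const_zero, norm_zero] at this
  have h5 : ∑ a, ‖(v - v') a‖ ^ 2 ≤ 0 := by
    by_contra hc
    push Not at hc
    nlinarith
  have h6 := (Finset.sum_eq_zero_iff_of_nonneg (s := Finset.univ)
    (f := fun a => ‖(v - v') a‖ ^ 2) (fun a _ => by positivity)).1
    (le_antisymm h5 (Finset.sum_nonneg fun a _ => by positivity))
  ext a
  have := h6 a (Finset.mem_univ a)
  simpa [sub_eq_zero] using this

lemma isUnit_sub_smul (H : Matrix m m ℂ) (hH : H.IsHermitian) (η : ℂ) (hη : η.im ≠ 0) :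
    IsUnit (H - η • (1 : Matrix m m ℂ)) := by
  have : H - η • (1 : Matrix m m ℂ) = H + diagonal (fun _ => -η) := by
    rw [sub_eq_add_neg, smul_one_eq_diagonal, diagonal_neg]
  rw [this]
  rcases lt_or_gt_of_ne hη with h | h
  · exact isUnit_herm H hH _ 1 (-η.im) (by simp) (by linarith) (by simp)
  · exact isUnit_herm H hH _ (-1) (η.im) (by simp) (by linarith) (by simp)

lemma inv_entry_bound (H : Matrix m m ℂ) (hH : H.IsHermitian) (d : m → ℂ) (s y : ℝ) (hs : |s| = 1)
    (hy : 0 < y) (hd : ∀ a, y ≤ s * (d a).im) (a b : m) : ‖(H + diagonal d)⁻¹ a b‖ ≤ 1 / y := by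
  have hu := isUnit_herm H hH d s y hs hy hd
  set v : m → ℂ := fun a => (H + diagonal d)⁻¹ a b with hv
  have h0 : (H + diagonal d) *ᵥ v = fun a => (1 : Matrix m m ℂ) a b := by
    ext c
    rw [← Matrix.mul_nonsing_inv _ ((Matrix.isUnit_iff_isUnit_det _).1 hu)]
    rfl
  have h1 := quad_bound H hH d s y hs hd _ _ h0
  have h2 : ∑ a, (starRingEnd ℂ) (v a) * (1 : Matrix m m ℂ) a b = (starRingEnd ℂ) (v b) := by
    simp [Matrix.one_apply]
  rw [h2, RCLike.norm_conj] at h1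
  have h3 : ∀ c, ‖v c‖ ^ 2 ≤ ∑ a, ‖v a‖ ^ 2 := fun c =>
    Finset.single_le_sum (f := fun a => ‖v a‖ ^ 2) (fun a _ => by positivity) (Finset.mem_univ c)
  have h4 : ‖v b‖ ≤ 1 / y := by
    rw [le_div_iff₀ hy]
    by_contra hc
    push Not at hc
    have := h3 b
    have hp : 0 < ‖v b‖ := by
      by_contra h; 
      have : ‖v b‖ = 0 := le_antisymm (not_lt.1 h) (norm_nonneg _)
      rw [this] at hc; linarith
    nlinarith [mul_le_mul_of_nonneg_left this hy.le]
  have h5 : ‖v a‖ ^ 2 ≤ (1 / y) ^ 2 := by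
    have : ∑ a, ‖v a‖ ^ 2 ≤ (1/y) ^ 2 := by
      have : ∑ a, ‖v a‖ ^ 2 ≤ ‖v b‖ / y := by rw [le_div_iff₀ hy]; linarith
      calc _ ≤ _ := this
        _ ≤ (1 / y) / y := by gcongr
        _ = _ := by field_simp
    exact (h3 a).trans this
  exact abs_le_of_sq_le_sq' h5 (by positivity) |>.2

lemma contraction (H : Matrix m m ℂ) (hH : H.IsHermitian) (d d' : m → ℂ) (s y : ℝ) (hs : |s| = 1)
    (hy : 0 < y) (hd : ∀ a, y ≤ s * (d a).im) (hd' : ∀ a, y ≤ s * (d' a).im) (M : ℝ)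
    (hM : ∀ a, ‖d a - d' a‖ ≤ M) (a b : m) :
    ‖(H + diagonal d)⁻¹ a b - (H + diagonal d')⁻¹ a b‖ ≤ (Fintype.card m / y ^ 2) * M := by
  have hu := (Matrix.isUnit_iff_isUnit_det _).1 (isUnit_herm H hH d s y hs hy hd)
  have hu' := (Matrix.isUnit_iff_isUnit_det _).1 (isUnit_herm H hH d' s y hs hy hd')
  have key : (H + diagonal d)⁻¹ - (H + diagonal d')⁻¹ =
      (H + diagonal d)⁻¹ * diagonal (fun c => d' c - d c) * (H + diagonal d')⁻¹ := by
    have : diagonal (fun c => d' c - d c) = (H + diagonal d') - (H + diagonal d) := by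
      rw [add_sub_add_left_eq_sub, diagonal_sub]
    rw [this, Matrix.mul_sub, Matrix.sub_mul, Matrix.nonsing_inv_mul _ hu, Matrix.mul_assoc,
      Matrix.mul_nonsing_inv _ hu', Matrix.mul_one, Matrix.one_mul]
  have key2 : (H + diagonal d)⁻¹ a b - (H + diagonal d')⁻¹ a b =
    ∑ c, (H + diagonal d)⁻¹ a c * (d' c - d c) * (H + diagonal d')⁻¹ c b := by
    rw [← Matrix.sub_apply, key, Matrix.mul_apply]
    simp [Matrix.mul_diagonal]
  rw [key2]
  calc _ ≤ ∑ c, ‖(H + diagonal d)⁻¹ a c * (d' c - d c) * (H + diagonal d')⁻¹ c b‖ := norm_sum_le _ _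
    _ ≤ ∑ c : m, (1 / y) * M * (1 / y) := by
      refine Finset.sum_le_sum fun c _ => ?_
      rw [norm_mul, norm_mul]
      have hM0 : 0 ≤ M := (norm_nonneg _).trans (hM c)
      gcongr
      · exact inv_entry_bound H hH d s y hs hy hd _ _
      · rw [norm_sub_rev]; exact hM c
      · exact inv_entry_bound H hH d' s y hs hy hd' _ _
    _ = _ := by simp; field_simp

/-- `G` is the corner of the resolvent of a finite Hermitian matrix. -/
def Res (C : ℝ) (G : ℂ → Matrix m m ℂ) : Prop :=
  ∃ (ι : Type) (_ : Fintype ι) (_ : DecidableEq ι) (H : Matrix (m ⊕ ι) (m ⊕ ι) ℂ),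
    H.IsHermitian ∧ (∑ a : m, (H * H) (Sum.inl a) (Sum.inl a)).re ≤ C ∧
    ∀ η : ℂ, η.im ≠ 0 → ∀ a b, G η a b = (H - η • (1 : Matrix (m ⊕ ι) (m ⊕ ι) ℂ))⁻¹ (Sum.inl a) (Sum.inl b)

/-- Right-hand side of the Dyson equation. -/
def dys (B : Matrix m m ℂ) (s : m → m → ℝ) (G : Matrix m m ℂ) (η : ℂ) : Matrix m m ℂ :=
  B - η • (1 : Matrix m m ℂ) - diagonal (fun a => ∑ b, ((s a b : ℂ)) ^ 2 * G b b)

lemma schur_corner {p q : Type} [Fintype p] [DecidableEq p] [Fintype q] [DecidableEq q]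
    (A : Matrix p p ℂ) (B : Matrix p q ℂ) (C : Matrix q p ℂ) (D : Matrix q q ℂ)
    (hD : IsUnit D) (hM : IsUnit (fromBlocks A B C D)) :
    IsUnit (A - B * D⁻¹ * C) ∧ ∀ a b, (fromBlocks A B C D)⁻¹ (Sum.inl a) (Sum.inl b) =
      (A - B * D⁻¹ * C)⁻¹ a b := by
  let := hD.invertible
  have h1 : IsUnit (A - B * ⅟D * C) := isUnit_fromBlocks_iff_of_invertible₂₂.1 hM
  let := h1.invertible
  let := hM.invertible
  have := invOf_fromBlocks₂₂_eq A B C D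
  simp only [invOf_eq_nonsing_inv] at this h1
  refine ⟨h1, fun a b => ?_⟩
  rw [this]; rfl

open scoped Kronecker in
lemma Res.step {C : ℝ} {G : ℂ → Matrix m m ℂ} (hG : Res C G) (B : Matrix m m ℂ)
    (hB : B.IsHermitian) (s : m → m → ℝ) :
    Res ((∑ a, (B * B) a a).re + ∑ a, ∑ b, (s a b) ^ 2) (fun η => (dys B s (G η) η)⁻¹) ∧
    ∀ η : ℂ, η.im ≠ 0 → IsUnit (dys B s (G η) η) := by
  obtain ⟨ι, i1, i2, H, hH, -, hR⟩ := hG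
  let W : Matrix ((m × m) × (m ⊕ ι)) m ℂ := fun p a =>
    if p.1.1 = a ∧ p.2 = Sum.inl p.1.2 then (s a p.1.2 : ℂ) else 0
  let K : Matrix ((m × m) × (m ⊕ ι)) ((m × m) × (m ⊕ ι)) ℂ := (1 : Matrix (m × m) (m × m) ℂ) ⊗ₖ H
  have hK : K.IsHermitian := by
    change Kᴴ = K
    rw [Matrix.conjTranspose_kronecker, Matrix.conjTranspose_one, hH.eq]
  let H' := fromBlocks B Wᴴ W K
  have hH' : H'.IsHermitian := Matrix.IsHermitian.fromBlocks hB (conjTranspose_conjTranspose W) hK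
  have hsub : ∀ η : ℂ, H' - η • 1 = fromBlocks (B - η • 1) Wᴴ W (K - η • 1) := by
    intro η
    rw [← fromBlocks_one, fromBlocks_smul, sub_eq_add_neg, fromBlocks_neg, fromBlocks_add]
    simp [sub_eq_add_neg]
  have hKη : ∀ η : ℂ, K - η • 1 = (1 : Matrix (m × m) (m × m) ℂ) ⊗ₖ (H - η • 1) := by
    intro η
    rw [← Matrix.one_kronecker_one (α := ℂ) (m := m × m) (n := m ⊕ ι), ← Matrix.kronecker_smul]
    ext p q
    simp [K, Matrix.kronecker_apply, mul_sub]
  have hW : ∀ R : Matrix (m ⊕ ι) (m ⊕ ι) ℂ, Wᴴ * ((1 : Matrix (m × m) (m × m) ℂ) ⊗ₖ R) * W =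
      diagonal (fun a => ∑ b, ((s a b : ℂ)) ^ 2 * R (Sum.inl b) (Sum.inl b)) := by
    intro R
    have h1 : ∀ p c, (((1 : Matrix (m × m) (m × m) ℂ) ⊗ₖ R) * W) p c =
        if p.1.1 = c then (s c p.1.2 : ℂ) * R p.2 (Sum.inl p.1.2) else 0 := by
      rintro ⟨⟨a, b⟩, k⟩ c
      rw [Matrix.mul_apply, Fintype.sum_prod_type]
      simp only [Matrix.kronecker_apply, Matrix.one_apply, W]
      rw [Finset.sum_eq_single (a, b)]
      · by_cases hac : a = c <;> simp [hac, mul_comm]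
      · intro q _ hq
        simp [Ne.symm hq]
      · simp
    have h2 : ∀ p a, Wᴴ a p = if p.1.1 = a ∧ p.2 = Sum.inl p.1.2 then (s a p.1.2 : ℂ) else 0 := by
      intro p a
      rw [Matrix.conjTranspose_apply]
      change star (if p.1.1 = a ∧ p.2 = Sum.inl p.1.2 then (s a p.1.2 : ℂ) else 0) = _
      split_ifs <;> simp
    ext a c
    rw [Matrix.mul_assoc, Matrix.mul_apply]
    simp_rw [h1, h2]
    simp only [Fintype.sum_prod_type]
    rw [Finset.sum_eq_single a]
    · by_cases hac : a = c
      · subst hac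
        simp only [diagonal_apply_eq, if_true, true_and]
        refine Finset.sum_congr rfl fun b _ => ?_
        rw [Finset.sum_eq_single (Sum.inl b)]
        · simp; ring
        · intro k _ hk; simp [hk]
        · simp
      · simp [hac]
    · intro x _ hx
      simp [hx]
    · simp
  have hWW : Wᴴ * W = diagonal (fun a => ∑ b, ((s a b : ℂ)) ^ 2) := by
    have := hW 1
    rw [Matrix.one_kronecker_one, Matrix.mul_one] at this
    rw [this]; simp
  have hS : ∀ η : ℂ, η.im ≠ 0 → (B - η • 1) - Wᴴ * (K - η • 1)⁻¹ * W = dys B s (G η) η := by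
    intro η hη
    rw [hKη, Matrix.inv_kronecker, inv_one, hW, dys]
    simp_rw [hR η hη]
  have main : ∀ η : ℂ, η.im ≠ 0 → IsUnit (dys B s (G η) η) ∧ ∀ a b,
      (H' - η • 1)⁻¹ (Sum.inl a) (Sum.inl b) = (dys B s (G η) η)⁻¹ a b := by
    intro η hη
    have := schur_corner (B - η • 1) Wᴴ W (K - η • 1) (isUnit_sub_smul K hK η hη)
      (by rw [← hsub]; exact isUnit_sub_smul H' hH' η hη)
    rwa [hS η hη, ← hsub] at this
  refine ⟨⟨_, inferInstance, inferInstance, H', hH', ?_, fun η hη a b => ((main η hη).2 a b).symm⟩,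
    fun η hη => (main η hη).1⟩
  have : ∀ a, (H' * H') (Sum.inl a) (Sum.inl a) = (B * B) a a + ∑ b, ((s a b : ℂ)) ^ 2 := by
    intro a
    simp only [H', fromBlocks_multiply, fromBlocks_apply₁₁, Matrix.add_apply]
    rw [hWW]; simp
  simp_rw [this]
  rw [Finset.sum_add_distrib, Complex.add_re]
  apply le_of_eq
  congr 1
  norm_cast
end LinAlg

section MeasPart
variable {m : Type} [Fintype m]

abbrev BallX (m : Type) [Fintype m] : Type := ↥(Metric.closedBall (0 : EuclideanSpace ℂ m) 1)

def qf (a b : m) (w : BallX m) : ℂ :=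
  (Fintype.card m : ℂ) * ((w : EuclideanSpace ℂ m) a * (starRingEnd ℂ) ((w : EuclideanSpace ℂ m) b))

lemma qf_cont (a b : m) : Continuous (qf a b) := by
  unfold qf
  have h : ∀ a : m, Continuous fun w : BallX m => (w : EuclideanSpace ℂ m) a := fun a => by fun_prop
  have := h a
  have := h b
  fun_prop

lemma qf_bound (a b : m) (w : BallX m) : ‖qf a b w‖ ≤ Fintype.card m := by
  unfold qf
  have hw : ‖(w : EuclideanSpace ℂ m)‖ ≤ 1 := mem_closedBall_zero_iff.1 w.2
  have h : ∀ a : m, ‖(w : EuclideanSpace ℂ m) a‖ ≤ 1 := fun a =>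
    (PiLp.norm_apply_le _ a).trans hw
  rw [norm_mul, norm_mul, RCLike.norm_conj]
  simp only [Complex.norm_natCast]
  have := mul_le_mul (h a) (h b) (norm_nonneg _) zero_le_one
  nlinarith [(Nat.cast_nonneg (Fintype.card m) : (0:ℝ) ≤ _)]

/-- matrix valued Stieltjes transform -/
def St (ν : Measure (ℝ × BallX m)) (η : ℂ) : Matrix m m ℂ :=
  Matrix.of fun a b => ∫ p, ((p.1 : ℂ) - η)⁻¹ * qf a b p.2 ∂ν

lemma herm_resolvent {k : Type} [Fintype k] [DecidableEq k] (H : Matrix k k ℂ)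
    (hH : H.IsHermitian) : ∃ (U : Matrix k k ℂ) (l : k → ℝ), U * Uᴴ = 1 ∧
      (∀ a b, (H * H) a b = ∑ j, ((l j : ℂ)) ^ 2 * (U a j * (starRingEnd ℂ) (U b j))) ∧
      ∀ η : ℂ, η.im ≠ 0 → ∀ a b, (H - η • (1 : Matrix k k ℂ))⁻¹ a b =
        ∑ j, ((l j : ℂ) - η)⁻¹ * (U a j * (starRingEnd ℂ) (U b j)) := by
  let U : Matrix k k ℂ := (hH.eigenvectorUnitary : Matrix k k ℂ)
  have hU : U * Uᴴ = 1 := Unitary.mul_star_self_of_mem hH.eigenvectorUnitary.2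
  have hU' : Uᴴ * U = 1 := Unitary.star_mul_self_of_mem hH.eigenvectorUnitary.2
  have hsp : H = U * diagonal (fun j => (hH.eigenvalues j : ℂ)) * Uᴴ := by
    have := hH.spectral_theorem
    rw [Unitary.conjStarAlgAut_apply] at this
    exact this
  have hent : ∀ (f : k → ℂ) a b, (U * diagonal f * Uᴴ) a b =
      ∑ j, f j * (U a j * (starRingEnd ℂ) (U b j)) := by
    intro f a b
    rw [Matrix.mul_apply]
    refine Finset.sum_congr rfl fun j _ => ?_
    rw [Matrix.mul_diagonal, Matrix.conjTranspose_apply, RCLike.star_def]; ring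
  refine ⟨U, hH.eigenvalues, hU, fun a b => ?_, fun η hη a b => ?_⟩
  · rw [← hent]
    refine congrFun (congrFun ?_ a) b
    conv_lhs => rw [hsp]
    calc _ = U * diagonal (fun j => (hH.eigenvalues j : ℂ)) * (Uᴴ * U) *
        diagonal (fun j => (hH.eigenvalues j : ℂ)) * Uᴴ := by simp only [Matrix.mul_assoc]
      _ = _ := by
        rw [hU', Matrix.mul_one, Matrix.mul_assoc U, diagonal_mul_diagonal]
        simp only [sq]
  · rw [← hent]
    refine congrFun (congrFun ?_ a) b
    apply Matrix.inv_eq_right_inv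
    have h1 : H - η • (1 : Matrix k k ℂ) = U * diagonal (fun j => (hH.eigenvalues j : ℂ) - η) * Uᴴ := by
      rw [← diagonal_sub, Matrix.mul_sub, Matrix.sub_mul, ← hsp, ← smul_one_eq_diagonal]
      simp [hU]
    rw [h1]
    calc _ = U * diagonal (fun j => (hH.eigenvalues j : ℂ) - η) * (Uᴴ * U) *
        diagonal (fun j => ((hH.eigenvalues j : ℂ) - η)⁻¹) * Uᴴ := by simp only [Matrix.mul_assoc]
      _ = 1 := by
        rw [hU', Matrix.mul_one, Matrix.mul_assoc U, diagonal_mul_diagonal]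
        have : (fun j => ((hH.eigenvalues j : ℂ) - η) * ((hH.eigenvalues j : ℂ) - η)⁻¹) = 1 := by
          ext j
          refine mul_inv_cancel₀ fun h => hη ?_
          have := congrArg Complex.im h
          simpa using this
        rw [this]
        simp [hU]

lemma Res.measure [DecidableEq m] [Nonempty m] {C : ℝ} {G : ℂ → Matrix m m ℂ} (hG : Res C G) :
    ∃ ν : ProbabilityMeasure (ℝ × BallX m),
      (∫⁻ p, ENNReal.ofReal (p.1 ^ 2) ∂(ν : Measure (ℝ × BallX m)) ≤ ENNReal.ofReal C) ∧
      (∀ a b, ∫ p, qf a b p.2 ∂(ν : Measure (ℝ × BallX m)) = (1 : Matrix m m ℂ) a b) ∧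
      ∀ η : ℂ, η.im ≠ 0 → G η = St (ν : Measure (ℝ × BallX m)) η := by
  obtain ⟨ι, i1, i2, H, hH, hC, hR⟩ := hG
  obtain ⟨U, l, hU, hHH, hres⟩ := herm_resolvent H hH
  set c : ℝ := (Fintype.card m : ℝ) with hc
  have hc1 : 1 ≤ c := by rw [hc]; exact_mod_cast Fintype.card_pos
  let v : m ⊕ ι → EuclideanSpace ℂ m := fun j => WithLp.toLp 2 fun a => U (Sum.inl a) j
  let w : m ⊕ ι → BallX m := fun j => ⟨((‖v j‖⁻¹ : ℝ) : ℂ) • v j, by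
    rw [mem_closedBall_zero_iff, norm_smul, Complex.norm_real, norm_inv, norm_norm]
    exact inv_mul_le_one⟩
  have hvq : ∀ j a b, ((‖v j‖ ^ 2 / c : ℝ) : ℂ) * qf a b (w j) =
      U (Sum.inl a) j * (starRingEnd ℂ) (U (Sum.inl b) j) := by
    intro j a b
    have e : ∀ a, (w j : EuclideanSpace ℂ m) a = ((‖v j‖⁻¹ : ℝ) : ℂ) * U (Sum.inl a) j := fun a => rfl
    unfold qf
    rw [e, e]
    by_cases h0 : ‖v j‖ = 0
    · have : ∀ a, U (Sum.inl a) j = 0 := by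
        intro a
        have h := norm_eq_zero.1 h0
        have := congrArg (fun x : EuclideanSpace ℂ m => x a) h
        simpa using this
      simp [this]
    · have h0' : (‖v j‖ : ℂ) ≠ 0 := by exact_mod_cast h0
      have hc0 : (Fintype.card m : ℂ) ≠ 0 := by exact_mod_cast Fintype.card_ne_zero
      rw [hc]
      push_cast
      rw [map_mul, map_inv₀, Complex.conj_ofReal]
      field_simp
  have hvn : ∀ j, ((‖v j‖ ^ 2 : ℝ) : ℂ) = ∑ a, U (Sum.inl a) j * (starRingEnd ℂ) (U (Sum.inl a) j) := by
    intro j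
    rw [EuclideanSpace.norm_sq_eq]
    push_cast
    refine Finset.sum_congr rfl fun a _ => ?_
    rw [Complex.mul_conj, Complex.normSq_eq_norm_sq]; push_cast; rfl
  have hUU : ∀ a b : m, ∑ j, U (Sum.inl a) j * (starRingEnd ℂ) (U (Sum.inl b) j) = (1 : Matrix m m ℂ) a b := by
    intro a b
    have := congrFun (congrFun hU (Sum.inl a)) (Sum.inl b)
    rw [Matrix.mul_apply] at this
    simp only [Matrix.conjTranspose_apply, RCLike.star_def] at this
    rw [this]
    simp [Matrix.one_apply]
  have hmass : ∑ j, ‖v j‖ ^ 2 / c = 1 := by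
    rw [← Finset.sum_div, div_eq_one_iff_eq (by linarith)]
    have : ((∑ j, ‖v j‖ ^ 2 : ℝ) : ℂ) = ((c : ℝ) : ℂ) := by
      rw [Complex.ofReal_sum]
      simp_rw [hvn]
      rw [Finset.sum_comm]
      simp_rw [hUU]
      simp [hc]
    exact_mod_cast this
  let ν : Measure (ℝ × BallX m) := ∑ j, ENNReal.ofReal (‖v j‖ ^ 2 / c) • Measure.dirac (l j, w j)
  have hnn : ∀ j, 0 ≤ ‖v j‖ ^ 2 / c := fun j => by positivity
  have hν : IsProbabilityMeasure ν := ⟨by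
    simp only [ν, Measure.coe_finsetSum, Finset.sum_apply, Measure.smul_apply, measure_univ,
      smul_eq_mul, mul_one]
    rw [← ENNReal.ofReal_sum_of_nonneg fun j _ => hnn j, hmass, ENNReal.ofReal_one]⟩
  have hint : ∀ f : ℝ × BallX m → ℂ, ∫ p, f p ∂ν = ∑ j, ((‖v j‖ ^ 2 / c : ℝ) : ℂ) * f (l j, w j) := by
    intro f
    simp only [ν]
    rw [integral_finsetSum_measure]
    · refine Finset.sum_congr rfl fun j _ => ?_
      rw [integral_smul_measure, integral_dirac, ENNReal.toReal_ofReal (hnn j), Complex.real_smul]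
    · intro j _
      exact (integrable_dirac (by simp)).smul_measure ENNReal.ofReal_ne_top
  refine ⟨⟨ν, hν⟩, ?_, ?_, ?_⟩
  · change ∫⁻ p, ENNReal.ofReal (p.1 ^ 2) ∂ν ≤ _
    simp only [ν]
    rw [lintegral_finsetSum_measure]
    simp only [lintegral_smul_measure, lintegral_dirac, smul_eq_mul]
    simp_rw [← ENNReal.ofReal_mul (hnn _)]
    rw [← ENNReal.ofReal_sum_of_nonneg fun j _ => mul_nonneg (hnn j) (sq_nonneg _)]
    apply ENNReal.ofReal_le_ofReal
    refine le_trans ?_ hC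
    have : (∑ a : m, (H * H) (Sum.inl a) (Sum.inl a)) = ((∑ j, ‖v j‖ ^ 2 * l j ^ 2 : ℝ) : ℂ) := by
      simp_rw [hHH]
      rw [Finset.sum_comm, Complex.ofReal_sum]
      refine Finset.sum_congr rfl fun j _ => ?_
      rw [← Finset.mul_sum, Complex.ofReal_mul, hvn]; push_cast; ring
    rw [this, Complex.ofReal_re]
    refine Finset.sum_le_sum fun j _ => ?_
    gcongr
    exact div_le_self (by positivity) hc1
  · intro a b
    change ∫ p, qf a b p.2 ∂ν = _
    rw [hint]
    simp_rw [hvq, hUU]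
  · intro η hη
    ext a b
    rw [hR η hη, hres η hη]
    change _ = ∫ p, ((p.1 : ℂ) - η)⁻¹ * qf a b p.2 ∂ν
    rw [hint]
    refine Finset.sum_congr rfl fun j _ => ?_
    rw [← hvq]; ring

lemma tight_compact (C : ℝ) : IsCompact (closure {ν : ProbabilityMeasure (ℝ × BallX m) |
    ∫⁻ p, ENNReal.ofReal (p.1 ^ 2) ∂(ν : Measure (ℝ × BallX m)) ≤ ENNReal.ofReal C}) := by
  apply isCompact_closure_of_isTightMeasureSet
  rw [isTightMeasureSet_iff_exists_isCompact_measure_compl_le]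
  intro ε hε
  obtain ⟨R, hR0, hR⟩ : ∃ R : ℝ, 0 < R ∧ ENNReal.ofReal C / ENNReal.ofReal (R ^ 2) ≤ ε := by
    have h1 : Tendsto (fun R : ℝ => ENNReal.ofReal C / ENNReal.ofReal (R ^ 2)) atTop (𝓝 0) := by
      have : Tendsto (fun R : ℝ => ENNReal.ofReal (R ^ 2)) atTop (𝓝 ⊤) :=
        ENNReal.tendsto_ofReal_atTop.comp (tendsto_pow_atTop two_ne_zero)
      simpa using ENNReal.Tendsto.const_div this (Or.inr ENNReal.ofReal_ne_top)
    have h2 := (h1.eventually (gt_mem_nhds hε)).and (eventually_gt_atTop (0:ℝ))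
    obtain ⟨R, hR⟩ := h2.exists
    exact ⟨R, hR.2, hR.1.le⟩
  refine ⟨Set.Icc (-R) R ×ˢ Set.univ, isCompact_Icc.prod isCompact_univ, ?_⟩
  rintro _ ⟨ν, hν, rfl⟩
  refine le_trans ?_ hR
  rw [ENNReal.le_div_iff_mul_le (Or.inl (by simp; positivity)) (Or.inl ENNReal.ofReal_ne_top), mul_comm]
  refine le_trans ?_ hν
  refine le_trans ?_ (mul_meas_ge_le_lintegral₀ (by fun_prop) (ENNReal.ofReal (R ^ 2)))
  gcongr
  rintro ⟨t, w⟩ h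
  simp only [Set.mem_compl_iff, Set.mem_prod, Set.mem_Icc, Set.mem_univ, and_true, not_and_or,
    not_le] at h
  simp only [Set.mem_ofPred_eq]
  apply ENNReal.ofReal_le_ofReal
  rcases h with h | h <;> nlinarith

end MeasPart

section Analytic

lemma cauchy_diff {Ω : Type} [MeasurableSpace Ω] (ν : Measure Ω) [IsFiniteMeasure ν] (p : Ω → ℝ)
    (q : Ω → ℂ) (hp : Measurable p) (hq : Measurable q) (c : ℝ) (hc : ∀ ω, ‖q ω‖ ≤ c)
    (U : Set ℂ) (hU : IsOpen U) (hpU : ∀ᵐ ω ∂ν, (p ω : ℂ) ∉ U) :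
    DifferentiableOn ℂ (fun z => ∫ ω, ((p ω : ℂ) - z)⁻¹ * q ω ∂ν) U := by
  intro z0 hz0
  apply DifferentiableAt.differentiableWithinAt
  obtain ⟨r, hr, hball⟩ := Metric.isOpen_iff.1 hU z0 hz0
  set δ := r / 2 with hδ
  have hδ0 : 0 < δ := by positivity
  have hlow : ∀ᵐ ω ∂ν, ∀ z ∈ Metric.ball z0 δ, δ ≤ ‖(p ω : ℂ) - z‖ := by
    filter_upwards [hpU] with ω hω z hz
    have h1 : r ≤ ‖(p ω : ℂ) - z0‖ := by
      by_contra h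
      push Not at h
      exact hω (hball (by rw [Metric.mem_ball, dist_eq_norm]; exact h))
    have h2 : ‖z - z0‖ < δ := by rw [← dist_eq_norm]; exact hz
    have h3 : ‖(p ω : ℂ) - z0‖ ≤ ‖(p ω : ℂ) - z‖ + ‖z - z0‖ := by
      calc _ = ‖((p ω : ℂ) - z) + (z - z0)‖ := by ring_nf
        _ ≤ _ := norm_add_le _ _
    linarith
  have hmeas : ∀ z : ℂ, Measurable fun ω => ((p ω : ℂ) - z)⁻¹ * q ω := fun z => by fun_prop
  have hmeas' : ∀ z : ℂ, Measurable fun ω => (((p ω : ℂ) - z) ^ 2)⁻¹ * q ω := fun z => by fun_prop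
  refine (hasDerivAt_integral_of_dominated_loc_of_deriv_le (𝕜 := ℂ)
    (F := fun z ω => ((p ω : ℂ) - z)⁻¹ * q ω)
    (F' := fun z ω => (((p ω : ℂ) - z) ^ 2)⁻¹ * q ω) (bound := fun _ => (δ ^ 2)⁻¹ * c)
    (Metric.ball_mem_nhds z0 hδ0) (Eventually.of_forall fun z => (hmeas z).aestronglyMeasurable)
    ?_ (hmeas' z0).aestronglyMeasurable ?_ (integrable_const _) ?_).2.differentiableAt
  · refine Integrable.of_bound (hmeas z0).aestronglyMeasurable (δ⁻¹ * c) ?_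
    filter_upwards [hlow] with ω hω
    rw [norm_mul, norm_inv]
    have := hω z0 (Metric.mem_ball_self hδ0)
    gcongr
    exact hc ω
  · filter_upwards [hlow] with ω hω z hz
    rw [norm_mul, norm_inv, norm_pow]
    have := hω z hz
    gcongr
    exact hc ω
  · filter_upwards [hlow] with ω hω z hz
    have hne : (p ω : ℂ) - z ≠ 0 := by
      intro h
      have := hω z hz
      rw [h, norm_zero] at this
      linarith
    have h1 : HasDerivAt (fun z : ℂ => (p ω : ℂ) - z) (-1) z := by
      simpa using (hasDerivAt_id z).const_sub (p ω : ℂ)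
    have h2 := (h1.inv hne).mul_const (q ω)
    have e : (((p ω : ℂ) - z) ^ 2)⁻¹ * q ω = -(-1) / ((p ω : ℂ) - z) ^ 2 * q ω := by
      simp [div_eq_mul_inv]
    exact e ▸ h2

lemma identity_ray {f g : ℂ → ℂ} {U : Set ℂ} (hU : IsOpen U) (hUc : IsPreconnected U)
    (hf : DifferentiableOn ℂ f U) (hg : DifferentiableOn ℂ g U) (c : ℂ) (hc : c ≠ 0) (x0 : ℝ)
    (hmem : c * ((x0 + 1 : ℝ) : ℂ) ∈ U) (h : ∀ x : ℝ, x0 < x → f (c * x) = g (c * x)) :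
    ∀ z ∈ U, f z = g z := by
  refine (hf.analyticOnNhd hU).eqOn_of_preconnected_of_frequently_eq (hg.analyticOnNhd hU) hUc hmem ?_
  have ht : Tendsto (fun x : ℝ => c * (x : ℂ)) (𝓝[≠] (x0 + 1)) (𝓝[≠] (c * ((x0 + 1 : ℝ) : ℂ))) := by
    apply tendsto_nhdsWithin_of_tendsto_nhds_of_eventually_within
    · exact (Continuous.tendsto (by fun_prop) _).mono_left nhdsWithin_le_nhds
    · filter_upwards [self_mem_nhdsWithin] with x hx
      simp only [Set.mem_compl_iff, Set.mem_singleton_iff] at hx ⊢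
      intro h'
      exact hx (by exact_mod_cast mul_left_cancel₀ hc h')
  refine ht.frequently (Eventually.frequently ?_)
  have : ∀ᶠ x in 𝓝[≠] (x0 + 1), x0 < x :=
    nhdsWithin_le_nhds (lt_mem_nhds (by linarith))
  filter_upwards [this] with x hx using h x hx

end Analytic

section Lim
variable {m : Type} [Fintype m]

lemma norm_res_le (t : ℝ) (η : ℂ) (hη : η.im ≠ 0) : ‖((t : ℂ) - η)⁻¹‖ ≤ |η.im|⁻¹ := by
  rw [norm_inv]
  have : |η.im| ≤ ‖(t : ℂ) - η‖ := by
    have := Complex.abs_im_le_norm ((t : ℂ) - η)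
    simpa using this
  have h0 : 0 < |η.im| := abs_pos.2 hη
  gcongr

lemma res_ne (t : ℝ) (η : ℂ) (hη : η.im ≠ 0) : (t : ℂ) - η ≠ 0 := by
  intro h
  have := congrArg Complex.im h
  simp at this
  exact hη this

lemma St_integrable (ν : Measure (ℝ × BallX m)) [IsFiniteMeasure ν] (η : ℂ) (hη : η.im ≠ 0) (a b : m) :
    Integrable (fun p : ℝ × BallX m => ((p.1 : ℂ) - η)⁻¹ * qf a b p.2) ν := by
  have hq := (qf_cont a b).measurable
  refine Integrable.of_bound (by fun_prop) (|η.im|⁻¹ * Fintype.card m) (Eventually.of_forall fun p => ?_)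
  rw [norm_mul]
  exact mul_le_mul (norm_res_le _ _ hη) (qf_bound _ _ _) (norm_nonneg _) (by positivity)

lemma St_tendsto {F : Filter ℕ} {νs : ℕ → ProbabilityMeasure (ℝ × BallX m)}
    {ν : ProbabilityMeasure (ℝ × BallX m)} (h : Tendsto νs F (𝓝 ν)) (η : ℂ) (hη : η.im ≠ 0) :
    Tendsto (fun p => St (νs p : Measure (ℝ × BallX m)) η) F (𝓝 (St (ν : Measure (ℝ × BallX m)) η)) := by
  rw [ProbabilityMeasure.tendsto_iff_forall_integral_rclike_tendsto ℂ] at h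
  refine tendsto_pi_nhds.2 fun a => tendsto_pi_nhds.2 fun b => ?_
  have hq := qf_cont a b
  refine h (BoundedContinuousFunction.ofNormedAddCommGroup
    (fun p : ℝ × BallX m => ((p.1 : ℂ) - η)⁻¹ * qf a b p.2) ?_ (|η.im|⁻¹ * Fintype.card m) ?_)
  · refine Continuous.mul (Continuous.inv₀ (by fun_prop) fun p => res_ne _ _ hη) (by fun_prop)
  · intro p
    rw [norm_mul]
    exact mul_le_mul (norm_res_le _ _ hη) (qf_bound _ _ _) (norm_nonneg _) (by positivity)

lemma qf_tendsto {F : Filter ℕ} {νs : ℕ → ProbabilityMeasure (ℝ × BallX m)}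
    {ν : ProbabilityMeasure (ℝ × BallX m)} (h : Tendsto νs F (𝓝 ν)) (a b : m) :
    Tendsto (fun p => ∫ x, qf a b x.2 ∂(νs p : Measure (ℝ × BallX m))) F
      (𝓝 (∫ x, qf a b x.2 ∂(ν : Measure (ℝ × BallX m)))) := by
  rw [ProbabilityMeasure.tendsto_iff_forall_integral_rclike_tendsto ℂ] at h
  have hq := qf_cont a b
  exact h (BoundedContinuousFunction.ofNormedAddCommGroup
    (fun p : ℝ × BallX m => qf a b p.2) (by fun_prop) (Fintype.card m) fun p => qf_bound _ _ _)

lemma qf_self (b : m) (w : BallX m) :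
    qf b b w = ((Fintype.card m * ‖(w : EuclideanSpace ℂ m) b‖ ^ 2 : ℝ) : ℂ) := by
  unfold qf
  rw [Complex.mul_conj, Complex.normSq_eq_norm_sq]; push_cast; rfl

lemma St_im_nonneg (ν : Measure (ℝ × BallX m)) [IsFiniteMeasure ν] (η : ℂ) (hη : 0 < η.im) (b : m) :
    0 ≤ (St ν η b b).im := by
  change 0 ≤ (∫ p, ((p.1 : ℂ) - η)⁻¹ * qf b b p.2 ∂ν).im
  have := integral_im (𝕜 := ℂ) (St_integrable ν η hη.ne' b b)
  simp only [RCLike.im_eq_complex_im] at this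
  rw [← this]
  refine integral_nonneg fun p => ?_
  simp only [Pi.zero_apply]
  rw [qf_self, Complex.im_mul_ofReal]
  refine mul_nonneg ?_ (by positivity)
  rw [Complex.inv_im]
  have := Complex.normSq_nonneg ((p.1 : ℂ) - η)
  simp only [Complex.sub_im, Complex.ofReal_im, zero_sub, neg_neg]
  positivity

lemma St_conj (ν : Measure (ℝ × BallX m)) (η : ℂ) (a b : m) :
    St ν ((starRingEnd ℂ) η) a b = (starRingEnd ℂ) (St ν η b a) := by
  change ∫ p, ((p.1 : ℂ) - (starRingEnd ℂ) η)⁻¹ * qf a b p.2 ∂ν =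
    (starRingEnd ℂ) (∫ p, ((p.1 : ℂ) - η)⁻¹ * qf b a p.2 ∂ν)
  rw [← integral_conj]
  congr 1
  ext p
  simp [qf, mul_comm]

/-- If two matrix transforms agree high on the imaginary axis, they agree. -/
lemma St_ext (ν ν' : Measure (ℝ × BallX m)) [IsFiniteMeasure ν] [IsFiniteMeasure ν'] (y0 : ℝ)
    (hy0 : 0 < y0) (h : ∀ y : ℝ, y0 < y → St ν (I * y) = St ν' (I * y)) (η : ℂ) (hη : η.im ≠ 0) :
    St ν η = St ν' η := by
  have hU : IsOpen {z : ℂ | 0 < z.im} := isOpen_lt continuous_const Complex.continuous_im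
  have hUc : IsPreconnected {z : ℂ | 0 < z.im} := (convex_halfSpace_im_gt 0).isPreconnected
  have hd : ∀ (ν : Measure (ℝ × BallX m)) [IsFiniteMeasure ν] (a b : m),
      DifferentiableOn ℂ (fun z => St ν z a b) {z : ℂ | 0 < z.im} := by
    intro ν _ a b
    exact cauchy_diff ν (fun p => p.1) (fun p => qf a b p.2) measurable_fst
      ((qf_cont a b).measurable.comp measurable_snd) _ (fun p => qf_bound a b p.2) _ hU
      (Eventually.of_forall fun p => by simp)
  have up : ∀ a b, ∀ z ∈ {z : ℂ | 0 < z.im}, St ν z a b = St ν' z a b := by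
    intro a b
    refine identity_ray hU hUc (hd ν a b) (hd ν' a b) I I_ne_zero y0 ?_ ?_
    · simp; linarith
    · intro x hx; rw [h x hx]
  ext a b
  rcases lt_or_gt_of_ne hη with h' | h'
  · have e : η = (starRingEnd ℂ) ((starRingEnd ℂ) η) := by simp
    rw [e, St_conj, St_conj ν', up]
    simpa using h'
  · exact up a b η h'

end Lim

section Dyson
variable {m : Type} [Fintype m] [DecidableEq m]

lemma Res.mono {C C' : ℝ} {G : ℂ → Matrix m m ℂ} (h : Res C G) (hC : C ≤ C') : Res C' G := by
  obtain ⟨ι, i1, i2, H, hH, h1, hR⟩ := h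
  exact ⟨ι, i1, i2, H, hH, h1.trans hC, hR⟩

lemma Res.zero : Res 0 (fun η => (-η⁻¹) • (1 : Matrix m m ℂ)) := by
  refine ⟨Empty, inferInstance, inferInstance, 0, isHermitian_zero, by simp, fun η hη a b => ?_⟩
  have hη0 : η ≠ 0 := by rintro rfl; simp at hη
  have : ((0 : Matrix (m ⊕ Empty) (m ⊕ Empty) ℂ) - η • 1)⁻¹ = (-η⁻¹) • 1 := by
    apply Matrix.inv_eq_right_inv
    simp [hη0]
  rw [this]
  simp [Matrix.one_apply]

lemma dys_eq (B : Matrix m m ℂ) (s : m → m → ℝ) (G : Matrix m m ℂ) (η : ℂ) :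
    dys B s G η = B + diagonal (fun a => -η - ∑ b, ((s a b : ℂ)) ^ 2 * G b b) := by
  unfold dys
  rw [smul_one_eq_diagonal, sub_sub, diagonal_add, sub_eq_add_neg, diagonal_neg]
  congr 2
  ext a
  simp [sub_eq_add_neg]
  ring

lemma dys_contr (B : Matrix m m ℂ) (hB : B.IsHermitian) (s : m → m → ℝ) (y : ℝ) (hy : 0 < y)
    (G G' : Matrix m m ℂ) (hG : ∀ a, 0 ≤ (∑ b, ((s a b : ℂ)) ^ 2 * G b b).im)
    (hG' : ∀ a, 0 ≤ (∑ b, ((s a b : ℂ)) ^ 2 * G' b b).im) (M : ℝ) (hM : ∀ b, ‖G b b - G' b b‖ ≤ M)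
    (a b : m) : ‖(dys B s G (I * y))⁻¹ a b - (dys B s G' (I * y))⁻¹ a b‖ ≤
      (Fintype.card m / y ^ 2) * ((∑ a, ∑ b, (s a b) ^ 2) * M) := by
  rw [dys_eq, dys_eq]
  have hM0 : 0 ≤ M := (norm_nonneg _).trans (hM b)
  refine contraction B hB _ _ (-1) y (by simp) hy ?_ ?_ _ ?_ a b
  · intro a
    have := hG a
    have him : (I * (y : ℂ)).im = y := by simp
    rw [Complex.sub_im, Complex.neg_im, him]
    linarith
  · intro a
    have := hG' a
    have him : (I * (y : ℂ)).im = y := by simp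
    rw [Complex.sub_im, Complex.neg_im, him]
    linarith
  · intro a
    rw [sub_sub_sub_cancel_left, ← Finset.sum_sub_distrib]
    calc _ ≤ ∑ b, ‖((s a b : ℂ)) ^ 2 * G' b b - ((s a b : ℂ)) ^ 2 * G b b‖ := norm_sum_le _ _
      _ ≤ ∑ b, (s a b) ^ 2 * M := by
        refine Finset.sum_le_sum fun b _ => ?_
        rw [← mul_sub, norm_mul, norm_pow, Complex.norm_real, Real.norm_eq_abs, sq_abs, norm_sub_rev]
        gcongr
        exact hM b
      _ = (∑ b, (s a b) ^ 2) * M := by rw [Finset.sum_mul]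
      _ ≤ _ := by
        refine mul_le_mul_of_nonneg_right ?_ hM0
        exact Finset.single_le_sum (f := fun a => ∑ b, (s a b) ^ 2)
          (fun a _ => Finset.sum_nonneg fun b _ => sq_nonneg _) (Finset.mem_univ a)

lemma sum_im_nonneg (s : m → m → ℝ) (G : Matrix m m ℂ) (hG : ∀ b, 0 ≤ (G b b).im) (a : m) :
    0 ≤ (∑ b, ((s a b : ℂ)) ^ 2 * G b b).im := by
  rw [Complex.im_sum]
  refine Finset.sum_nonneg fun b _ => ?_
  rw [← Complex.ofReal_pow, Complex.im_ofReal_mul]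
  exact mul_nonneg (sq_nonneg _) (hG b)

/-- the iterates -/
def Gs (B : Matrix m m ℂ) (s : m → m → ℝ) : ℕ → ℂ → Matrix m m ℂ
  | 0 => fun η => (-η⁻¹) • (1 : Matrix m m ℂ)
  | p + 1 => fun η => (dys B s (Gs B s p η) η)⁻¹

/-- threshold ensuring contraction -/
def ythr (s : m → m → ℝ) : ℝ := 2 * Fintype.card m * (∑ a, ∑ b, (s a b) ^ 2) + 1

lemma ythr_spec (s : m → m → ℝ) : 1 ≤ ythr s ∧ ∀ y, ythr s < y →
    (Fintype.card m / y ^ 2) * (∑ a, ∑ b, (s a b) ^ 2) ≤ 1 / 2 := by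
  have hS : 0 ≤ ∑ a, ∑ b, (s a b) ^ 2 :=
    Finset.sum_nonneg fun a _ => Finset.sum_nonneg fun b _ => sq_nonneg _
  have h1 : 1 ≤ ythr s := by unfold ythr; have : (0:ℝ) ≤ Fintype.card m := by positivity
                             nlinarith [mul_nonneg this hS]
  refine ⟨h1, fun y hy => ?_⟩
  have hy1 : 1 < y := lt_of_le_of_lt h1 hy
  rw [div_mul_eq_mul_div, div_le_iff₀ (by positivity)]
  unfold ythr at hy
  nlinarith

theorem dyson_exists [Nonempty m] (B : Matrix m m ℂ) (hB : B.IsHermitian) (s : m → m → ℝ)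
    (j : m → ℂ) (hj : ∀ a, j a * j a = 1) (hjB : ∀ a b, j a * B a b * j b = - B a b) :
    ∃ ν ν' : ProbabilityMeasure (ℝ × BallX m),
      (∀ a b, ∫ p, qf a b p.2 ∂(ν : Measure (ℝ × BallX m)) = (1 : Matrix m m ℂ) a b) ∧
      (∀ a b, ∫ p, qf a b p.2 ∂(ν' : Measure (ℝ × BallX m)) = (1 : Matrix m m ℂ) a b) ∧
      (∀ η : ℂ, η.im ≠ 0 → dys B s (St (ν : Measure (ℝ × BallX m)) η) η * St (ν : Measure (ℝ × BallX m)) η = 1) ∧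
      (∀ η : ℂ, η.im ≠ 0 → dys 0 s (St (ν : Measure (ℝ × BallX m)) η) η * St (ν' : Measure (ℝ × BallX m)) η = 1) ∧
      (∀ η : ℂ, η.im ≠ 0 → ∀ a b, St (ν : Measure (ℝ × BallX m)) (-η) a b =
        -(j a * St (ν : Measure (ℝ × BallX m)) η a b * j b)) := by
  set C1 := max 0 ((∑ a, (B * B) a a).re + ∑ a, ∑ b, (s a b) ^ 2) with hC1
  have hres : ∀ p, Res C1 (Gs B s p) := by
    intro p
    induction p with
    | zero => exact Res.zero.mono (le_max_left _ _)
    | succ p ih => exact (ih.step B hB s).1.mono (le_max_right _ _)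
  choose νs hν1 hν2 hν3 using fun p => (hres p).measure
  choose νd hd1 hd2 hd3 using fun p => (((hres p).step 0 isHermitian_zero s).1).measure
  let 𝒰 := hyperfilter ℕ
  have hlim : ∀ (C : ℝ) (μs : ℕ → ProbabilityMeasure (ℝ × BallX m)),
      (∀ p, ∫⁻ x, ENNReal.ofReal (x.1 ^ 2) ∂(μs p : Measure (ℝ × BallX m)) ≤ ENNReal.ofReal C) →
      ∃ μ, Tendsto μs 𝒰 (𝓝 μ) := by
    intro C μs h
    obtain ⟨μ, -, hμ⟩ := (tight_compact (m := m) C).ultrafilter_le_nhds (𝒰.map μs) (by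
      rw [le_principal_iff]
      exact Filter.mem_map.2 (Filter.univ_mem' fun p => subset_closure (h p)))
    exact ⟨μ, hμ⟩
  obtain ⟨ν, hν⟩ := hlim _ νs hν1
  obtain ⟨ν', hν'⟩ := hlim _ νd hd1
  obtain ⟨ν1, hν1'⟩ := hlim _ (fun p => νs (p + 1)) (fun p => hν1 (p + 1))
  have hG : ∀ η : ℂ, η.im ≠ 0 → Tendsto (fun p => Gs B s p η) 𝒰 (𝓝 (St (ν : Measure (ℝ × BallX m)) η)) := by
    intro η hη
    simp_rw [fun p => hν3 p η hη]
    exact St_tendsto hν η hη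
  have hG1 : ∀ η : ℂ, η.im ≠ 0 → Tendsto (fun p => Gs B s (p + 1) η) 𝒰 (𝓝 (St (ν1 : Measure (ℝ × BallX m)) η)) := by
    intro η hη
    simp_rw [fun p => hν3 (p + 1) η hη]
    exact St_tendsto hν1' η hη
  have hD : ∀ η : ℂ, η.im ≠ 0 → Tendsto (fun p => (dys 0 s (Gs B s p η) η)⁻¹) 𝒰 (𝓝 (St (ν' : Measure (ℝ × BallX m)) η)) := by
    intro η hη
    simp_rw [fun p => hd3 p η hη]
    exact St_tendsto hν' η hη
  have hle : (𝒰 : Filter ℕ) ≤ atTop := Nat.hyperfilter_le_atTop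
  have heq : ∀ η : ℂ, η.im ≠ 0 → St (ν1 : Measure (ℝ × BallX m)) η = St (ν : Measure (ℝ × BallX m)) η := by
    have hy1 := (ythr_spec s).1
    refine St_ext _ _ (ythr s) (by linarith) fun y hy => ?_
    have hy0 : 0 < y := by linarith
    have him : (I * (y : ℂ)).im = y := by simp
    have hy' : (I * (y : ℂ)).im ≠ 0 := by rw [him]; exact hy0.ne'
    set M0 := ∑ a, ∑ b, ‖Gs B s 1 (I * y) a b - Gs B s 0 (I * y) a b‖ with hM0
    have hnn : ∀ p a, 0 ≤ (∑ b, ((s a b : ℂ)) ^ 2 * Gs B s p (I * y) b b).im := by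
      intro p
      apply sum_im_nonneg
      intro b
      rw [hν3 p _ hy']
      exact St_im_nonneg _ _ (by rw [him]; exact hy0) b
    have hgeo : ∀ p a b, ‖Gs B s (p + 1) (I * y) a b - Gs B s p (I * y) a b‖ ≤ (1 / 2) ^ p * M0 := by
      intro p
      induction p with
      | zero =>
        intro a b
        rw [pow_zero, one_mul]
        refine (Finset.single_le_sum (f := fun b => ‖Gs B s 1 (I * y) a b - Gs B s 0 (I * y) a b‖)
          (fun _ _ => norm_nonneg _) (Finset.mem_univ b)).trans ?_
        exact Finset.single_le_sum (f := fun a => ∑ b, ‖Gs B s 1 (I * y) a b - Gs B s 0 (I * y) a b‖)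
          (fun _ _ => Finset.sum_nonneg fun _ _ => norm_nonneg _) (Finset.mem_univ a)
      | succ p ih =>
        intro a b
        refine (dys_contr B hB s y hy0 _ _ (hnn (p + 1)) (hnn p) _ (fun b => ih b b) a b).trans ?_
        have h2 := (ythr_spec s).2 y hy
        have h3 : 0 ≤ (1 / 2 : ℝ) ^ p * M0 := (norm_nonneg _).trans (ih a b)
        rw [← mul_assoc]
        calc _ ≤ (1 / 2) * ((1 / 2 : ℝ) ^ p * M0) := by gcongr
          _ = _ := by ring
    ext a b
    have t1 : Tendsto (fun p => Gs B s (p + 1) (I * y) a b - Gs B s p (I * y) a b) 𝒰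
        (𝓝 (St (ν1 : Measure (ℝ × BallX m)) (I * y) a b - St (ν : Measure (ℝ × BallX m)) (I * y) a b)) :=
      ((hG1 _ hy').apply_nhds a |>.apply_nhds b).sub ((hG _ hy').apply_nhds a |>.apply_nhds b)
    have t2 : Tendsto (fun p => Gs B s (p + 1) (I * y) a b - Gs B s p (I * y) a b) 𝒰 (𝓝 0) := by
      refine Tendsto.mono_left ?_ hle
      refine squeeze_zero_norm (fun p => hgeo p a b) ?_
      simpa using (tendsto_pow_atTop_nhds_zero_of_lt_one (by norm_num : (0:ℝ) ≤ 1/2) (by norm_num)).mul_const M0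
    exact sub_eq_zero.1 (tendsto_nhds_unique t1 t2)
  have hdysc : ∀ (B : Matrix m m ℂ) (η : ℂ), Continuous fun G : Matrix m m ℂ => dys B s G η := by
    intro B η
    unfold dys
    refine continuous_const.sub (Continuous.matrix_diagonal ?_)
    refine continuous_pi fun a => continuous_finsetSum _ fun b _ => ?_
    exact continuous_const.mul (continuous_id.matrix_elem b b)
  refine ⟨ν, ν', ?_, ?_, ?_, ?_, ?_⟩
  · intro a b
    refine tendsto_nhds_unique (qf_tendsto hν a b) ?_
    simp_rw [hν2]
    exact tendsto_const_nhds
  · intro a b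
    refine tendsto_nhds_unique (qf_tendsto hν' a b) ?_
    simp_rw [hd2]
    exact tendsto_const_nhds
  · intro η hη
    have t1 := (((hdysc B η).tendsto _).comp (hG η hη)).mul (hG1 η hη)
    rw [heq η hη] at t1
    refine tendsto_nhds_unique t1 ?_
    refine tendsto_const_nhds.congr fun p => ?_
    exact (Matrix.mul_nonsing_inv _ ((Matrix.isUnit_iff_isUnit_det _).1
      (((hres p).step B hB s).2 η hη))).symm
  · intro η hη
    have t1 := (((hdysc 0 η).tendsto _).comp (hG η hη)).mul (hD η hη)
    refine tendsto_nhds_unique t1 ?_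
    refine tendsto_const_nhds.congr fun p => ?_
    exact (Matrix.mul_nonsing_inv _ ((Matrix.isUnit_iff_isUnit_det _).1
      (((hres p).step 0 isHermitian_zero s).2 η hη))).symm
  · intro η hη
    have hη' : (-η).im ≠ 0 := by simpa using hη
    have hJJ : diagonal j * diagonal j = 1 := by
      rw [diagonal_mul_diagonal]; simp [hj]
    have hodd : ∀ p, Gs B s p (-η) = -(diagonal j * Gs B s p η * diagonal j) := by
      intro p
      induction p with
      | zero => 
        simp only [Gs, inv_neg, neg_neg]
        rw [Matrix.mul_smul, Matrix.mul_one, Matrix.smul_mul, hJJ]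
        simp
      | succ p ih =>
        have hu := (Matrix.isUnit_iff_isUnit_det _).1 (((hres p).step B hB s).2 η hη)
        change (dys B s (Gs B s p (-η)) (-η))⁻¹ = -(diagonal j * (dys B s (Gs B s p η) η)⁻¹ * diagonal j)
        have e : dys B s (Gs B s p (-η)) (-η) = -(diagonal j * dys B s (Gs B s p η) η * diagonal j) := by
          rw [ih, dys_eq, dys_eq]
          ext a b
          simp only [Matrix.add_apply, Matrix.neg_apply, Matrix.mul_diagonal, Matrix.diagonal_mul]
          have h1 := hjB a b
          by_cases hab : a = b
          · subst hab
            simp only [diagonal_apply_eq]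
            have : ∀ b, j b * Gs B s p η b b * j b = Gs B s p η b b := fun b => by
              rw [mul_right_comm, hj, one_mul]
            simp only [this, mul_neg, Finset.sum_neg_distrib]
            linear_combination h1 - (η + ∑ b, ((s a b : ℂ)) ^ 2 * Gs B s p η b b) * (hj a)
          · simp only [diagonal_apply_ne _ hab, add_zero]
            rw [h1, neg_neg]
        rw [e]
        apply Matrix.inv_eq_right_inv
        rw [neg_mul_neg]
        calc _ = diagonal j * dys B s (Gs B s p η) η * (diagonal j * diagonal j) *
            (dys B s (Gs B s p η) η)⁻¹ * diagonal j := by simp only [Matrix.mul_assoc]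
          _ = 1 := by rw [hJJ, Matrix.mul_one, Matrix.mul_assoc (diagonal j),
                Matrix.mul_nonsing_inv _ hu, Matrix.mul_one, hJJ]
    intro a b
    refine tendsto_nhds_unique ((hG _ hη').apply_nhds a |>.apply_nhds b) ?_
    have t := (((hG _ hη).apply_nhds a |>.apply_nhds b).const_mul (j a)).mul_const (j b) |>.neg
    refine t.congr fun p => ?_
    rw [hodd p]
    simp [Matrix.mul_diagonal, Matrix.diagonal_mul]

end Dyson

section Reps

lemma offRplus_open : IsOpen offRplus := by
  have : offRplus = ({z : ℂ | z.im = 0} ∩ {z : ℂ | 0 ≤ z.re})ᶜ := rfl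
  rw [this, isOpen_compl_iff]
  exact (isClosed_eq Complex.continuous_im continuous_const).inter
    (isClosed_le continuous_const Complex.continuous_re)

lemma ofReal_not_offRplus {t : ℝ} (ht : 0 ≤ t) : (t : ℂ) ∉ offRplus := by
  simp [offRplus, ht]

lemma neg_mem_offRplus {x : ℝ} (hx : 0 < x) : (-1 : ℂ) * x ∈ offRplus := by
  simp [offRplus, hx]

lemma offRplus_bound {z : ℂ} (hz : z ∈ offRplus) : ∃ c : ℝ, 0 ≤ c ∧ ∀ t : ℝ, 0 ≤ t →
    ‖((t : ℂ) - z)⁻¹‖ ≤ c := by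
  obtain ⟨r, hr, hball⟩ := Metric.isOpen_iff.1 offRplus_open z hz
  refine ⟨r⁻¹, by positivity, fun t ht => ?_⟩
  rw [norm_inv]
  have : r ≤ ‖(t : ℂ) - z‖ := by
    by_contra! h
    exact ofReal_not_offRplus ht (hball (by rw [mem_ball_iff_norm]; exact h))
  gcongr

lemma offRplus_preconnected : IsPreconnected offRplus := by
  have h : StarConvex ℝ (-1 : ℂ) offRplus := by
    intro z hz a b ha hb hab
    simp only [offRplus, Set.mem_setOf_eq, not_and, not_le] at hz ⊢
    intro h
    simp at h ⊢
    rcases h with h | h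
    · subst h; linarith
    · have := hz h
      by_cases hb0 : b = 0
      · subst hb0; linarith
      · have : 0 < b := lt_of_le_of_ne hb (Ne.symm hb0)
        nlinarith
  exact (h.isPathConnected (by simpa using neg_mem_offRplus one_pos)).isConnected.isPreconnected

lemma exists_sqrt {z : ℂ} (hz : z ∈ offRplus) : ∃ η : ℂ, η ^ 2 = z ∧ 0 < η.im := by
  obtain ⟨η, hη⟩ := IsAlgClosed.exists_pow_nat_eq z (n := 2) (by norm_num)
  rcases lt_trichotomy η.im 0 with h | h | h
  · exact ⟨-η, by rw [neg_sq, hη], by simpa using h⟩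
  · exfalso
    apply hz
    rw [← hη]
    simp [sq, h]
    exact mul_self_nonneg _
  · exact ⟨η, hη, h⟩

lemma stieltjes_of {Ω : Type} [MeasurableSpace Ω] (ν : Measure Ω) [IsFiniteMeasure ν] (p q : Ω → ℝ)
    (hp : Measurable p) (hp0 : ∀ ω, 0 ≤ p ω) (hq : Measurable q) (hq0 : ∀ ω, 0 ≤ q ω)
    (hq1 : ∫ ω, q ω ∂ν = 1) (f : ℂ → ℂ)
    (hf : ∀ z ∈ offRplus, f z = ∫ ω, ((p ω : ℂ) - z)⁻¹ * (q ω : ℂ) ∂ν) : IsStieltjesPM f := by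
  have hqi : Integrable q ν := by
    by_contra h
    rw [integral_undef h] at hq1
    exact zero_ne_one hq1
  have hqn : Measurable fun ω => (q ω).toNNReal := hq.real_toNNReal
  set ν1 := ν.withDensity (fun ω => ((q ω).toNNReal : ENNReal)) with hν1
  refine ⟨ν1.map p, ?_, ?_, ?_⟩
  · have : IsProbabilityMeasure ν1 := ⟨by
      rw [hν1, withDensity_apply _ MeasurableSet.univ, Measure.restrict_univ]
      change ∫⁻ ω, ENNReal.ofReal (q ω) ∂ν = 1
      rw [← ofReal_integral_eq_lintegral_ofReal hqi (Eventually.of_forall hq0), hq1,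
        ENNReal.ofReal_one]⟩
    exact Measure.isProbabilityMeasure_map hp.aemeasurable
  · rw [Measure.map_apply hp measurableSet_Iio]
    convert measure_empty (μ := ν1)
    ext ω
    simp [hp0 ω]
  · intro z hz
    rw [hf z hz, integral_map hp.aemeasurable (by fun_prop), hν1,
      integral_withDensity_eq_integral_smul hqn]
    refine integral_congr_ae (Eventually.of_forall fun ω => ?_)
    simp only [NNReal.smul_def, Real.coe_toNNReal _ (hq0 ω), Complex.real_smul]
    ring

variable {m : Type} [Fintype m] [DecidableEq m]

/-- Transform in the squared variable. -/
def Sq (ν : Measure (ℝ × BallX m)) (z : ℂ) (a b : m) : ℂ :=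
  ∫ p, (((p.1 ^ 2 : ℝ) : ℂ) - z)⁻¹ * qf a b p.2 ∂ν

lemma Sq_integrable (ν : Measure (ℝ × BallX m)) [IsFiniteMeasure ν] {z : ℂ} (hz : z ∈ offRplus)
    (a b : m) :
    Integrable (fun p : ℝ × BallX m => (((p.1 ^ 2 : ℝ) : ℂ) - z)⁻¹ * qf a b p.2) ν := by
  obtain ⟨c, hc0, hc⟩ := offRplus_bound hz
  have hq := (qf_cont a b).measurable
  refine Integrable.of_bound (by fun_prop) (c * Fintype.card m) (Eventually.of_forall fun p => ?_)
  rw [norm_mul]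
  exact mul_le_mul (hc _ (sq_nonneg _)) (qf_bound _ _ _) (norm_nonneg _) hc0

lemma Sq_of_odd (ν : Measure (ℝ × BallX m)) [IsFiniteMeasure ν] (η : ℂ) (hη : η.im ≠ 0) (a b : m)
    (hodd : St ν (-η) a b = -St ν η a b) : Sq ν (η ^ 2) a b = η⁻¹ * St ν η a b := by
  have hη0 : η ≠ 0 := by rintro rfl; simp at hη
  have hη' : (-η).im ≠ 0 := by simpa using hη
  have h1 : Sq ν (η ^ 2) a b = (2 * η)⁻¹ * (St ν η a b - St ν (-η) a b) := by
    change _ = (2 * η)⁻¹ * (∫ p, ((p.1 : ℂ) - η)⁻¹ * qf a b p.2 ∂ν -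
      ∫ p, ((p.1 : ℂ) - -η)⁻¹ * qf a b p.2 ∂ν)
    rw [← integral_sub (St_integrable ν η hη a b) (St_integrable ν _ hη' a b), ← integral_const_mul]
    refine integral_congr_ae (Eventually.of_forall fun p => ?_)
    have e1 := res_ne p.1 η hη
    have e2 := res_ne p.1 (-η) hη'
    have e3 : (((p.1 ^ 2 : ℝ) : ℂ) - η ^ 2) = ((p.1 : ℂ) - η) * ((p.1 : ℂ) - -η) := by
      push_cast; ring
    simp only
    rw [e3]
    field_simp
    ring
  rw [h1, hodd]
  field_simp
  ring

lemma qf_re_sum {ι : Type} [Fintype ι] (ν : Measure (ℝ × BallX m)) [IsFiniteMeasure ν] (e : ι → m)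
    (hm : ∀ i, ∫ p, qf (e i) (e i) p.2 ∂ν = 1) :
    ∫ p, (∑ i, (Fintype.card m * ‖(p.2 : EuclideanSpace ℂ m) (e i)‖ ^ 2 : ℝ)) ∂ν = Fintype.card ι := by
  have hi : ∀ a b, Integrable (fun p : ℝ × BallX m => qf a b p.2) ν := fun a b => by
    have hq : Measurable fun p : ℝ × BallX m => qf a b p.2 := (qf_cont a b).measurable.comp measurable_snd
    exact Integrable.of_bound hq.aestronglyMeasurable (Fintype.card m) (Eventually.of_forall fun p => qf_bound _ _ _)
  have : ((∫ p, (∑ i, (Fintype.card m * ‖(p.2 : EuclideanSpace ℂ m) (e i)‖ ^ 2 : ℝ)) ∂ν : ℝ) : ℂ) =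
      (Fintype.card ι : ℂ) := by
    rw [← integral_complex_ofReal]
    have : ∀ p : ℝ × BallX m, ((∑ i, (Fintype.card m * ‖(p.2 : EuclideanSpace ℂ m) (e i)‖ ^ 2 : ℝ) : ℝ) : ℂ)
        = ∑ i, qf (e i) (e i) p.2 := fun p => by
      rw [Complex.ofReal_sum]
      exact Finset.sum_congr rfl fun i _ => (qf_self _ _).symm
    simp_rw [this]
    rw [integral_finsetSum _ fun i _ => hi _ _]
    simp [hm]
  exact_mod_cast this

/-- Normalized traces are Stieltjes transforms of probability measures. -/
lemma Sq_stieltjes (ν : Measure (ℝ × BallX m)) [IsFiniteMeasure ν] {k : ℕ} (hk : 0 < k)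
    (e : Fin k → m) (hm : ∀ i, ∫ p, qf (e i) (e i) p.2 ∂ν = 1) (f : ℂ → ℂ)
    (hf : ∀ z ∈ offRplus, f z = (k : ℂ)⁻¹ * ∑ i, Sq ν z (e i) (e i)) : IsStieltjesPM f := by
  have hc : ∀ a : m, Measurable fun p : ℝ × BallX m => (p.2 : EuclideanSpace ℂ m) a := fun a => by
    have : Continuous fun p : ℝ × BallX m => (p.2 : EuclideanSpace ℂ m) a := by fun_prop
    exact this.measurable
  refine stieltjes_of ν (fun p => p.1 ^ 2)
    (fun p => (k : ℝ)⁻¹ * ∑ i, (Fintype.card m * ‖(p.2 : EuclideanSpace ℂ m) (e i)‖ ^ 2 : ℝ))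
    (by fun_prop) (fun p => sq_nonneg _) ?_ (fun p => by positivity) ?_ f ?_
  · refine Measurable.const_mul (Finset.measurable_fun_sum _ fun i _ => ?_) _
    exact ((hc (e i)).norm.pow_const 2).const_mul _
  · rw [integral_const_mul, qf_re_sum ν e hm, Fintype.card_fin]
    have : (k : ℝ) ≠ 0 := by exact_mod_cast hk.ne'
    field_simp
  · intro z hz
    rw [hf z hz]
    unfold Sq
    rw [← integral_finsetSum _ fun i _ => Sq_integrable ν hz _ _, ← integral_const_mul]
    refine integral_congr_ae (Eventually.of_forall fun p => ?_)
    simp only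
    rw [Complex.ofReal_mul, Complex.ofReal_sum, ← Finset.mul_sum]
    simp_rw [qf_self]
    push_cast
    ring

lemma Sq_rep (ν : Measure (ℝ × BallX m)) [IsProbabilityMeasure ν] {k : ℕ}
    (e : Fin k → m) (hm : ∀ i j, ∫ p, qf (e i) (e j) p.2 ∂ν = (1 : Matrix (Fin k) (Fin k) ℂ) i j)
    (F : ℂ → Matrix (Fin k) (Fin k) ℂ)
    (hF : ∀ z ∈ offRplus, ∀ i j, F z i j = Sq ν z (e i) (e j)) : HasUnitMatrixMeasureRep k F := by
  have : Nonempty (BallX m) := ⟨⟨0, by simp⟩⟩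
  have hΦ : Measurable fun p : ℝ × BallX m => (p.1 ^ 2, p.2) := by fun_prop
  set ν2 := ν.map (fun p : ℝ × BallX m => (p.1 ^ 2, p.2)) with hν2
  have : IsProbabilityMeasure ν2 := Measure.isProbabilityMeasure_map hΦ.aemeasurable
  have hqm : ∀ a b, Measurable (qf a b : BallX m → ℂ) := fun a b => (qf_cont a b).measurable
  have hq2 : ∀ a b, Measurable (fun p : ℝ × BallX m => qf a b p.2) := fun a b => (hqm a b).comp measurable_snd
  have hint : ∀ a b, Integrable (fun p : ℝ × BallX m => qf a b p.2) ν2 := fun a b =>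
    Integrable.of_bound (hq2 a b).aestronglyMeasurable (Fintype.card m) (Eventually.of_forall fun p => qf_bound _ _ _)
  have hqi : ∀ a b t, Integrable (qf a b) (ν2.condKernel t) := fun a b t =>
    Integrable.of_bound (hqm a b).aestronglyMeasurable (Fintype.card m) (Eventually.of_forall fun p => qf_bound _ _ _)
  have hz2 : ∀ z ∈ offRplus, ∀ a b, Integrable (fun p : ℝ × BallX m => ((p.1 : ℂ) - z)⁻¹ * qf a b p.2) ν2 := by
    intro z hz a b
    have := hq2 a b
    rw [hν2, integrable_map_measure (by fun_prop) hΦ.aemeasurable]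
    exact Sq_integrable ν hz a b
  refine ⟨ν2.fst, fun t => Matrix.of fun i j => ∫ w, qf (e i) (e j) w ∂(ν2.condKernel t), ?_, ?_, ?_, ?_, ?_, ?_⟩
  · rw [Measure.fst_apply measurableSet_Iio, hν2, Measure.map_apply hΦ (measurable_fst measurableSet_Iio)]
    convert measure_empty (μ := ν)
    ext p
    simp [sq_nonneg]
  · intro i j
    simp only [Matrix.of_apply]
    exact (StronglyMeasurable.integral_kernel (hqm (e i) (e j)).stronglyMeasurable).measurable
  · refine Eventually.of_forall fun t => ?_
    refine Matrix.PosSemidef.of_dotProduct_mulVec_nonneg ?_ ?_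
    · ext i j
      simp only [conjTranspose_apply, Matrix.of_apply, RCLike.star_def]
      rw [← integral_conj]
      congr 1
      ext w
      simp [qf, mul_comm]
    · intro x
      have e1 : star x ⬝ᵥ (Matrix.of fun i j => ∫ w, qf (e i) (e j) w ∂(ν2.condKernel t)) *ᵥ x =
          ∫ w, (∑ i, ∑ j, (starRingEnd ℂ) (x i) * (qf (e i) (e j) w * x j)) ∂(ν2.condKernel t) := by
        rw [integral_finsetSum]
        · simp only [dotProduct, mulVec, Matrix.of_apply, Pi.star_apply, RCLike.star_def]
          refine Finset.sum_congr rfl fun i _ => ?_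
          rw [integral_finsetSum, Finset.mul_sum]
          · refine Finset.sum_congr rfl fun j _ => ?_
            rw [integral_const_mul, integral_mul_const]
          · exact fun j _ => ((hqi _ _ t).mul_const _).const_mul _
        · exact fun i _ => integrable_finsetSum _ fun j _ => ((hqi _ _ t).mul_const _).const_mul _
      rw [e1]
      have e2 : ∀ w : BallX m, (∑ i, ∑ j, (starRingEnd ℂ) (x i) * (qf (e i) (e j) w * x j)) =
          ((Fintype.card m * ‖∑ j, (starRingEnd ℂ) (x j) * (w : EuclideanSpace ℂ m) (e j)‖ ^ 2 : ℝ) : ℂ) := by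
        intro w
        rw [Complex.ofReal_mul, ← Complex.normSq_eq_norm_sq, ← Complex.mul_conj, map_sum,
          Finset.sum_mul_sum, Finset.mul_sum]
        refine Finset.sum_congr rfl fun i _ => ?_
        rw [Finset.mul_sum]
        refine Finset.sum_congr rfl fun j _ => ?_
        simp [qf]
        ring
      simp_rw [e2]
      rw [integral_complex_ofReal]
      exact_mod_cast integral_nonneg fun w => by positivity
  · intro i j
    exact (hint (e i) (e j)).integral_condKernel
  · ext i j
    simp only [Matrix.of_apply]
    rw [Measure.integral_condKernel (hint (e i) (e j)), ← hm i j, hν2,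
      integral_map hΦ.aemeasurable (hq2 _ _).aestronglyMeasurable]
  · intro z hz
    constructor
    · intro i j
      have := (hz2 z hz (e i) (e j)).integral_condKernel
      simpa only [integral_const_mul, Matrix.of_apply] using this
    · ext i j
      rw [hF z hz]
      simp only [Matrix.of_apply]
      have := Measure.integral_condKernel (hz2 z hz (e i) (e j))
      simp only [integral_const_mul] at this
      rw [this, hν2, integral_map hΦ.aemeasurable (by have := hq2 (e i) (e j); fun_prop)]
      rfl

end Reps

section Blocks

lemma block_gen {p q : Type} [Fintype p] [DecidableEq p] [Fintype q] [DecidableEq q]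
    (P : Matrix p q ℂ) (Q : Matrix q p ℂ) (x : p → ℂ) (xt : q → ℂ) (η : ℂ) (hη : η ≠ 0)
    (hx : ∀ i, x i ≠ 0) (hxt : ∀ j, xt j ≠ 0) (X : Matrix p p ℂ) (Y : Matrix q p ℂ)
    (h1 : diagonal (fun i => (η * x i)⁻¹) * X + P * Y = 1)
    (h2 : Q * X + diagonal (fun j => (η * xt j)⁻¹) * Y = 0) :
    ((diagonal x)⁻¹ - η ^ 2 • (P * diagonal xt * Q))⁻¹ = η⁻¹ • X := by
  have hinv : (diagonal x)⁻¹ = diagonal (fun i => (x i)⁻¹) := by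
    apply Matrix.inv_eq_right_inv
    rw [diagonal_mul_diagonal]
    simp [hx]
  have hY : Y = -(diagonal (fun j => η * xt j) * (Q * X)) := by
    have h3 : diagonal (fun j => η * xt j) * (diagonal (fun j => (η * xt j)⁻¹) * Y) = Y := by
      rw [← Matrix.mul_assoc, diagonal_mul_diagonal]
      have : ∀ j, η * xt j * (η * xt j)⁻¹ = 1 := fun j => mul_inv_cancel₀ (mul_ne_zero hη (hxt j))
      simp only [this, diagonal_one, Matrix.one_mul]
    rw [← h3, eq_neg_of_add_eq_zero_right h2, Matrix.mul_neg]
  have e1 : diagonal (fun i => (η * x i)⁻¹) = η⁻¹ • diagonal (fun i => (x i)⁻¹) := by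
    rw [← diagonal_smul]; congr 1; ext i; simp [mul_comm]
  have e2 : diagonal (fun j => η * xt j) = η • diagonal xt := by
    rw [← diagonal_smul]; rfl
  apply Matrix.inv_eq_right_inv
  rw [hinv, ← h1, hY, e1, e2]
  simp only [Matrix.sub_mul, Matrix.smul_mul, Matrix.mul_smul, Matrix.mul_neg, smul_smul,
    Matrix.mul_assoc, sub_eq_add_neg, Matrix.add_mul, Matrix.neg_mul, smul_add, smul_neg]
  have e3 : η⁻¹ * η ^ 2 = η := by field_simp
  simp only [e3]

/-- Hermitization of `A`. -/
def Bm {N n : ℕ} (A : Matrix (Fin N) (Fin n) ℝ) : Matrix (Fin N ⊕ Fin n) (Fin N ⊕ Fin n) ℂ :=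
  fromBlocks 0 (A.map Complex.ofReal) (A.map Complex.ofReal)ᵀ 0

lemma Bm_herm {N n : ℕ} (A : Matrix (Fin N) (Fin n) ℝ) : (Bm A).IsHermitian := by
  ext a b
  rcases a with a | a <;> rcases b with b | b <;> simp [Bm]

/-- Hermitization of the variance profile. -/
def sm {N n : ℕ} (σ : Fin N → Fin n → ℝ) : (Fin N ⊕ Fin n) → (Fin N ⊕ Fin n) → ℝ
  | Sum.inl i, Sum.inr j => σ i j / Real.sqrt n
  | Sum.inr j, Sum.inl i => σ i j / Real.sqrt n
  | _, _ => 0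

lemma sm_sq {N n : ℕ} (σ : Fin N → Fin n → ℝ) (i : Fin N) (j : Fin n) :
    (((σ i j / Real.sqrt n : ℝ)) : ℂ) ^ 2 = (n : ℂ)⁻¹ * (σ i j : ℂ) ^ 2 := by
  rw [← Complex.ofReal_pow, div_pow, Real.sq_sqrt (Nat.cast_nonneg n)]
  push_cast
  ring

lemma sum_inl {N n : ℕ} (σ : Fin N → Fin n → ℝ) (G : Matrix (Fin N ⊕ Fin n) (Fin N ⊕ Fin n) ℂ)
    (i : Fin N) : ∑ b, ((sm σ (Sum.inl i) b : ℂ)) ^ 2 * G b b =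
      (n : ℂ)⁻¹ * ∑ j, (σ i j : ℂ) ^ 2 * G (Sum.inr j) (Sum.inr j) := by
  rw [Fintype.sum_sum_type, Finset.mul_sum]
  simp only [sm, sm_sq, Complex.ofReal_zero]
  simp [mul_assoc]

lemma sum_inr {N n : ℕ} (σ : Fin N → Fin n → ℝ) (G : Matrix (Fin N ⊕ Fin n) (Fin N ⊕ Fin n) ℂ)
    (j : Fin n) : ∑ b, ((sm σ (Sum.inr j) b : ℂ)) ^ 2 * G b b =
      (n : ℂ)⁻¹ * ∑ i, (σ i j : ℂ) ^ 2 * G (Sum.inl i) (Sum.inl i) := by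
  rw [Fintype.sum_sum_type, Finset.mul_sum]
  simp only [sm, sm_sq, Complex.ofReal_zero]
  simp [mul_assoc]

lemma scalar_iff (η x c S : ℂ) (hη : η ≠ 0) :
    x = -(η ^ 2 * (1 + c * (η⁻¹ * S)))⁻¹ ↔ (η * x)⁻¹ = -η - c * S := by
  rw [← inv_neg, ← inv_eq_iff_eq_inv, mul_inv]
  constructor
  · intro h; rw [h]; field_simp; ring
  · intro h
    have : x⁻¹ = η * (η⁻¹ * x⁻¹) := by field_simp
    rw [this, h]; field_simp; ring

lemma T_block {N n : ℕ} (A : Matrix (Fin N) (Fin n) ℝ) (ψ : Fin N → ℂ → ℂ) (ψt : Fin n → ℂ → ℂ)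
    (η : ℂ) (hη : η ≠ 0) (hx : ∀ i, ψ i (η ^ 2) ≠ 0) (hxt : ∀ j, ψt j (η ^ 2) ≠ 0)
    (d : Fin N ⊕ Fin n → ℂ) (hd : ∀ i, d (Sum.inl i) = (η * ψ i (η ^ 2))⁻¹)
    (hdt : ∀ j, d (Sum.inr j) = (η * ψt j (η ^ 2))⁻¹)
    (G : Matrix (Fin N ⊕ Fin n) (Fin N ⊕ Fin n) ℂ) (hG : (Bm A + diagonal d) * G = 1) :
    Tmat A ψ ψt (η ^ 2) = η⁻¹ • G.toBlocks₁₁ ∧ Ttmat A ψ ψt (η ^ 2) = η⁻¹ • G.toBlocks₂₂ := by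
  have hD : diagonal d = fromBlocks (diagonal fun i => (η * ψ i (η ^ 2))⁻¹) 0 0
      (diagonal fun j => (η * ψt j (η ^ 2))⁻¹) := by
    rw [fromBlocks_diagonal]
    congr 1
    ext a
    rcases a with a | a
    · exact hd a
    · exact hdt a
  rw [Bm, hD, fromBlocks_add, ← fromBlocks_toBlocks G, fromBlocks_multiply, ← fromBlocks_one,
    fromBlocks_inj] at hG
  simp only [zero_add, add_zero] at hG
  obtain ⟨h11, h12, h21, h22⟩ := hG
  constructor
  · exact block_gen _ _ (fun i => ψ i (η ^ 2)) (fun j => ψt j (η ^ 2)) η hη hx hxt _ _ h11 h21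
  · refine block_gen _ _ (fun j => ψt j (η ^ 2)) (fun i => ψ i (η ^ 2)) η hη hxt hx _ G.toBlocks₁₂ ?_ ?_
    · rw [add_comm]; exact h22
    · rw [add_comm]; exact h12

lemma trace_diag {k : ℕ} (u : Fin k → ℂ) (c : ℂ) (M : Matrix (Fin k) (Fin k) ℂ) :
    ((diagonal u) * (c • M)).trace = c * ∑ i, u i * M i i := by
  simp only [trace, diag_apply, diagonal_mul, Matrix.smul_apply, smul_eq_mul, Finset.mul_sum]
  exact Finset.sum_congr rfl fun i _ => by ring

/-- Pointwise equivalence between the system and the Dyson equation. -/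
lemma sys_iff {N n : ℕ} (σ : Fin N → Fin n → ℝ) (A : Matrix (Fin N) (Fin n) ℝ) (ψ : Fin N → ℂ → ℂ)
    (ψt : Fin n → ℂ → ℂ)
    (η : ℂ) (hη : η ≠ 0) (hx : ∀ i, ψ i (η ^ 2) ≠ 0) (hxt : ∀ j, ψt j (η ^ 2) ≠ 0)
    (d : Fin N ⊕ Fin n → ℂ) (hd : ∀ i, d (Sum.inl i) = (η * ψ i (η ^ 2))⁻¹)
    (hdt : ∀ j, d (Sum.inr j) = (η * ψt j (η ^ 2))⁻¹)
    (G : Matrix (Fin N ⊕ Fin n) (Fin N ⊕ Fin n) ℂ) (hG : (Bm A + diagonal d) * G = 1) :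
    ((∀ i, ψ i (η ^ 2)
      = -(η ^ 2 * (1 + (n : ℂ)⁻¹
          * ((Matrix.diagonal fun j => ((σ i j : ℂ))^2) * Ttmat A ψ ψt (η ^ 2)).trace))⁻¹) ∧
    (∀ j, ψt j (η ^ 2)
      = -(η ^ 2 * (1 + (n : ℂ)⁻¹
          * ((Matrix.diagonal fun i => ((σ i j : ℂ))^2) * Tmat A ψ ψt (η ^ 2)).trace))⁻¹)) ↔
    ∀ a, d a = -η - ∑ b, ((sm σ a b : ℂ)) ^ 2 * G b b := by
  obtain ⟨h1, h2⟩ := T_block A ψ ψt η hη hx hxt d hd hdt G hG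
  rw [h1, h2]
  simp only [trace_diag, scalar_iff _ _ _ _ hη, ← hd, ← hdt]
  constructor
  · rintro ⟨ha, hb⟩ (a | a)
    · rw [sum_inl]; exact ha a
    · rw [sum_inr]; exact hb a
  · intro h
    refine ⟨fun i => ?_, fun j => ?_⟩
    · rw [h, sum_inl]; rfl
    · rw [h, sum_inr]; rfl

end Blocks

section Uniq

lemma stieltjes_neg {f : ℂ → ℂ} (hf : IsStieltjesPM f) {x : ℝ} (hx : 0 < x) :
    ∃ r : ℝ, 0 < r ∧ r * x ≤ 1 ∧ f ((-1) * x) = r := by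
  obtain ⟨μ, hμ, h0, hf⟩ := hf
  have hae : ∀ᵐ t ∂μ, 0 ≤ t := by
    rw [ae_iff]; simpa [Set.Iio, not_le] using h0
  have hb : ∀ᵐ t ∂μ, 0 < (t + x)⁻¹ ∧ (t + x)⁻¹ ≤ x⁻¹ := by
    filter_upwards [hae] with t ht
    have : 0 < t + x := by linarith
    exact ⟨by positivity, inv_anti₀ hx (by linarith)⟩
  have hi : Integrable (fun t : ℝ => (t + x)⁻¹) μ := by
    refine Integrable.of_bound (by fun_prop) x⁻¹ ?_
    filter_upwards [hb] with t ht
    rw [Real.norm_of_nonneg ht.1.le]; exact ht.2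
  refine ⟨∫ t, (t + x)⁻¹ ∂μ, ?_, ?_, ?_⟩
  · have h1 : 0 ≤ ∫ t, (t + x)⁻¹ ∂μ := integral_nonneg_of_ae (hb.mono fun t ht => ht.1.le)
    refine lt_of_le_of_ne h1 fun h => ?_
    have h2 := (integral_eq_zero_iff_of_nonneg_ae (hb.mono fun t ht => ht.1.le) hi).1 h.symm
    have h3 : ∀ᵐ t ∂μ, False := by
      filter_upwards [h2, hb] with t h2 h3
      exact h3.1.ne' h2
    obtain ⟨t, ht⟩ := h3.exists
    exact ht
  · have h1 : ∫ t, (t + x)⁻¹ ∂μ ≤ ∫ t, x⁻¹ ∂μ :=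
      integral_mono_ae hi (integrable_const _) (hb.mono fun t ht => ht.2)
    simp at h1
    calc _ ≤ x⁻¹ * x := by gcongr
      _ = 1 := inv_mul_cancel₀ hx.ne'
  · rw [hf _ (neg_mem_offRplus hx), ← integral_complex_ofReal]
    refine integral_congr_ae (Eventually.of_forall fun t => ?_)
    simp

lemma stieltjes_diff {f : ℂ → ℂ} (hf : IsStieltjesPM f) : DifferentiableOn ℂ f offRplus := by
  obtain ⟨μ, hμ, h0, hf⟩ := hf
  have hae : ∀ᵐ t ∂μ, 0 ≤ t := by
    rw [ae_iff]; simpa [Set.Iio, not_le] using h0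
  have := cauchy_diff μ (fun t => t) (fun _ => 1) measurable_id measurable_const 1 (by simp) offRplus
    offRplus_open (hae.mono fun t ht => ofReal_not_offRplus ht)
  refine this.congr fun z hz => ?_
  rw [hf z hz]
  simp

lemma sol_point {N n : ℕ} (σ : Fin N → Fin n → ℝ) (A : Matrix (Fin N) (Fin n) ℝ) (ψ : Fin N → ℂ → ℂ)
    (ψt : Fin n → ℂ → ℂ) (h : SolvesSystem σ A ψ ψt) (y : ℝ) (hy : 0 < y) :
    ∃ G : Matrix (Fin N ⊕ Fin n) (Fin N ⊕ Fin n) ℂ, (dys (Bm A) (sm σ) G (I * y))⁻¹ = G ∧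
      (∀ a, 0 ≤ (∑ b, ((sm σ a b : ℂ)) ^ 2 * G b b).im) ∧
      (∀ i, (I * y * ψ i ((-1) * (y ^ 2 : ℝ)))⁻¹ = - (I * y) - ∑ b, ((sm σ (Sum.inl i) b : ℂ)) ^ 2 * G b b) ∧
      (∀ j, (I * y * ψt j ((-1) * (y ^ 2 : ℝ)))⁻¹ = - (I * y) - ∑ b, ((sm σ (Sum.inr j) b : ℂ)) ^ 2 * G b b) := by
  obtain ⟨hS, hSt, hsys⟩ := h
  have hy2 : 0 < y ^ 2 := by positivity
  have hz : (I * (y : ℂ)) ^ 2 = (-1) * ((y ^ 2 : ℝ) : ℂ) := by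
    rw [mul_pow, I_sq]; push_cast; rfl
  have hη : I * (y : ℂ) ≠ 0 := by simp [hy.ne']
  have him : (I * (y : ℂ)).im = y := by simp
  have hval : ∀ f : ℂ → ℂ, IsStieltjesPM f → f ((I * (y : ℂ)) ^ 2) ≠ 0 ∧
      y ≤ (-1) * ((I * y * f ((I * (y : ℂ)) ^ 2))⁻¹).im := by
    intro f hf
    obtain ⟨r, hr, hr1, hfr⟩ := stieltjes_neg hf hy2
    rw [hz, hfr]
    refine ⟨by exact_mod_cast hr.ne', ?_⟩
    have : (I * (y : ℂ) * (r : ℂ))⁻¹ = -I * (((y * r)⁻¹ : ℝ) : ℂ) := by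
      rw [mul_assoc, mul_inv, Complex.inv_I]; push_cast; rfl
    rw [this]
    simp only [Complex.im_mul_ofReal, Complex.neg_im, I_im]
    have : y ≤ (y * r)⁻¹ := by
      rw [le_inv_comm₀ hy (by positivity), ← one_div, le_div_iff₀ hy]; nlinarith
    linarith
  let d : Fin N ⊕ Fin n → ℂ := Sum.elim (fun i => (I * y * ψ i ((I * y) ^ 2))⁻¹)
    (fun j => (I * y * ψt j ((I * y) ^ 2))⁻¹)
  have hdim : ∀ a, y ≤ (-1) * (d a).im := by
    rintro (a | a)
    · exact (hval _ (hS a)).2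
    · exact (hval _ (hSt a)).2
  have hu := isUnit_herm (Bm A) (Bm_herm A) d (-1) y (by simp) hy hdim
  have hG := Matrix.mul_nonsing_inv _ ((Matrix.isUnit_iff_isUnit_det _).1 hu)
  have hd := (sys_iff σ A ψ ψt (I * y) hη (fun i => (hval _ (hS i)).1) (fun j => (hval _ (hSt j)).1)
    d (fun _ => rfl) (fun _ => rfl) _ hG).1 (hsys _ (by rw [hz]; exact neg_mem_offRplus hy2))
  refine ⟨(Bm A + diagonal d)⁻¹, ?_, ?_, ?_, ?_⟩
  · rw [dys_eq]
    congr 3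
    ext a
    exact (hd a).symm
  · intro a
    have h1 := hdim a
    rw [hd a, Complex.sub_im, Complex.neg_im, him] at h1
    linarith
  · intro i
    rw [← hd, ← hz]; rfl
  · intro j
    rw [← hd, ← hz]; rfl

lemma uniq {N n : ℕ} (σ : Fin N → Fin n → ℝ) (A : Matrix (Fin N) (Fin n) ℝ) (ψ φ : Fin N → ℂ → ℂ)
    (ψt φt : Fin n → ℂ → ℂ) (h : SolvesSystem σ A ψ ψt) (h' : SolvesSystem σ A φ φt) :
    ∀ z ∈ offRplus, (∀ i, ψ i z = φ i z) ∧ (∀ j, ψt j z = φt j z) := by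
  have key : ∀ x : ℝ, (ythr (sm σ)) ^ 2 < x → (∀ i, ψ i ((-1) * x) = φ i ((-1) * x)) ∧
      (∀ j, ψt j ((-1) * x) = φt j ((-1) * x)) := by
    intro x hx
    have hy1 := (ythr_spec (sm σ)).1
    obtain ⟨y, hy, hyx⟩ : ∃ y, ythr (sm σ) < y ∧ x = y ^ 2 :=
      ⟨Real.sqrt x, Real.lt_sqrt_of_sq_lt hx, (Real.sq_sqrt (by nlinarith)).symm⟩
    subst hyx
    have hy0 : 0 < y := by linarith
    obtain ⟨G, hG, hGi, hG1, hG2⟩ := sol_point σ A ψ ψt h y hy0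
    obtain ⟨G', hG', hGi', hG1', hG2'⟩ := sol_point σ A φ φt h' y hy0
    have hGG : ∀ a, G a a = G' a a := by
      intro a
      have : Nonempty (Fin N ⊕ Fin n) := ⟨a⟩
      obtain ⟨c, hc⟩ := Finite.exists_max fun b => ‖G b b - G' b b‖
      have h1 := dys_contr (Bm A) (Bm_herm A) (sm σ) y hy0 G G' hGi hGi' _ hc c c
      rw [hG, hG', ← mul_assoc] at h1
      have h2 := (ythr_spec (sm σ)).2 y hy
      have h3 := norm_nonneg (G c c - G' c c)
      have h4 := hc a
      have h5 := mul_le_mul_of_nonneg_right h2 h3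
      have h6 : ‖G a a - G' a a‖ ≤ 0 := by linarith
      exact sub_eq_zero.1 (norm_le_zero_iff.1 h6)
    have hη : I * (y : ℂ) ≠ 0 := by simp [hy0.ne']
    constructor
    · intro i
      have := hG1 i
      simp only [hGG] at this
      rw [← hG1' i] at this
      exact mul_left_cancel₀ hη (inv_injective this)
    · intro j
      have := hG2 j
      simp only [hGG] at this
      rw [← hG2' j] at this
      exact mul_left_cancel₀ hη (inv_injective this)
  have hmem : (-1 : ℂ) * (((ythr (sm σ)) ^ 2 + 1 : ℝ) : ℂ) ∈ offRplus := neg_mem_offRplus (by positivity)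
  intro z hz
  refine ⟨fun i => ?_, fun j => ?_⟩
  · exact identity_ray offRplus_open offRplus_preconnected (stieltjes_diff (h.1 i))
      (stieltjes_diff (h'.1 i)) (-1) (by simp) _ hmem (fun x hx => (key x hx).1 i) z hz
  · exact identity_ray offRplus_open offRplus_preconnected (stieltjes_diff (h.2.1 j))
      (stieltjes_diff (h'.2.1 j)) (-1) (by simp) _ hmem (fun x hx => (key x hx).2 j) z hz

end Uniq

section Exist

lemma exist_full (N n : ℕ) (hN : 0 < N) (hn : 0 < n)
    (σ : Fin N → Fin n → ℝ) (A : Matrix (Fin N) (Fin n) ℝ) :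
    ∃ ψ ψt, SolvesSystem σ A ψ ψt ∧ HasUnitMatrixMeasureRep N (Tmat A ψ ψt)
        ∧ HasUnitMatrixMeasureRep n (Ttmat A ψ ψt)
        ∧ IsStieltjesPM (fun z => (N : ℂ)⁻¹ * (Tmat A ψ ψt z).trace)
        ∧ IsStieltjesPM (fun z => (n : ℂ)⁻¹ * (Ttmat A ψ ψt z).trace) := by
  have : Nonempty (Fin N ⊕ Fin n) := ⟨Sum.inl ⟨0, hN⟩⟩
  obtain ⟨ν, ν', hm, hm', hB, hD, hodd⟩ := dyson_exists (Bm A) (Bm_herm A) (sm σ)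
    (Sum.elim (fun _ => 1) (fun _ => -1)) (by rintro (a | a) <;> simp)
    (by rintro (a | a) (b | b) <;> simp [Bm])
  have hoddL : ∀ η : ℂ, η.im ≠ 0 → ∀ i j, St (ν : Measure (ℝ × BallX (Fin N ⊕ Fin n))) (-η) (Sum.inl i) (Sum.inl j)
      = - St (ν : Measure (ℝ × BallX (Fin N ⊕ Fin n))) η (Sum.inl i) (Sum.inl j) := by
    intro η hη i j
    rw [hodd η hη]; simp
  have hoddR : ∀ η : ℂ, η.im ≠ 0 → ∀ i j, St (ν : Measure (ℝ × BallX (Fin N ⊕ Fin n))) (-η) (Sum.inr i) (Sum.inr j)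
      = - St (ν : Measure (ℝ × BallX (Fin N ⊕ Fin n))) η (Sum.inr i) (Sum.inr j) := by
    intro η hη i j
    rw [hodd η hη]; simp
  let d : ℂ → (Fin N ⊕ Fin n) → ℂ := fun η a =>
    -η - ∑ b, ((sm σ a b : ℂ)) ^ 2 * St (ν : Measure (ℝ × BallX (Fin N ⊕ Fin n))) η b b
  have hdD : ∀ η : ℂ, η.im ≠ 0 → ∀ a,
      d η a * St (ν' : Measure (ℝ × BallX (Fin N ⊕ Fin n))) η a a = 1 := by
    intro η hη a
    have := congrFun (congrFun (hD η hη) a) a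
    rw [dys_eq, zero_add, diagonal_mul, one_apply_eq] at this
    exact this
  have hdodd : ∀ η : ℂ, η.im ≠ 0 → ∀ a, d (-η) a = - d η a := by
    intro η hη a
    have h1 : ∀ b, St (ν : Measure (ℝ × BallX (Fin N ⊕ Fin n))) (-η) b b =
        - St (ν : Measure (ℝ × BallX (Fin N ⊕ Fin n))) η b b := by
      rintro (b | b)
      · exact hoddL η hη b b
      · exact hoddR η hη b b
    simp only [d, h1, mul_neg, Finset.sum_neg_distrib]
    ring
  have hDodd : ∀ η : ℂ, η.im ≠ 0 → ∀ a, St (ν' : Measure (ℝ × BallX (Fin N ⊕ Fin n))) (-η) a a =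
      - St (ν' : Measure (ℝ × BallX (Fin N ⊕ Fin n))) η a a := by
    intro η hη a
    have h1 := hdD η hη a
    have h2 := hdD (-η) (by simpa using hη) a
    rw [hdodd η hη] at h2
    have h3 : d η a ≠ 0 := left_ne_zero_of_mul_eq_one h1
    apply mul_left_cancel₀ h3
    linear_combination -h2 + h1
  have hη0 : ∀ η : ℂ, 0 < η.im → η ≠ 0 := by rintro η hη rfl; simp at hη
  let X : (Fin N ⊕ Fin n) → ℂ → ℂ := fun a z => Sq (ν' : Measure (ℝ × BallX (Fin N ⊕ Fin n))) z a a
  have hX : ∀ η : ℂ, 0 < η.im → ∀ a, X a (η ^ 2) ≠ 0 ∧ d η a = (η * X a (η ^ 2))⁻¹ := by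
    intro η hη a
    have h1 := hdD η hη.ne' a
    have h2 : X a (η ^ 2) = η⁻¹ * St (ν' : Measure (ℝ × BallX (Fin N ⊕ Fin n))) η a a :=
      Sq_of_odd _ η hη.ne' a a (hDodd η hη.ne' a)
    have h3 := hη0 η hη
    have h4 : St (ν' : Measure (ℝ × BallX (Fin N ⊕ Fin n))) η a a ≠ 0 := right_ne_zero_of_mul_eq_one h1
    rw [h2, mul_inv_cancel_left₀ h3]
    exact ⟨mul_ne_zero (inv_ne_zero h3) h4, eq_inv_of_mul_eq_one_left h1⟩
  have hGd : ∀ η : ℂ, 0 < η.im → (Bm A + diagonal (d η)) * St (ν : Measure (ℝ × BallX (Fin N ⊕ Fin n))) η = 1 := by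
    intro η hη
    rw [← hB η hη.ne', dys_eq]
  let ψ : Fin N → ℂ → ℂ := fun i => X (Sum.inl i)
  let ψt : Fin n → ℂ → ℂ := fun j => X (Sum.inr j)
  have hT : ∀ z ∈ offRplus, (∀ i j, Tmat A ψ ψt z i j = Sq (ν : Measure (ℝ × BallX (Fin N ⊕ Fin n))) z (Sum.inl i) (Sum.inl j)) ∧
      (∀ i j, Ttmat A ψ ψt z i j = Sq (ν : Measure (ℝ × BallX (Fin N ⊕ Fin n))) z (Sum.inr i) (Sum.inr j)) := by
    intro z hz
    obtain ⟨η, rfl, hη⟩ := exists_sqrt hz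
    obtain ⟨h1, h2⟩ := T_block A ψ ψt η (hη0 η hη) (fun i => (hX η hη _).1) (fun j => (hX η hη _).1)
      (d η) (fun i => (hX η hη _).2) (fun j => (hX η hη _).2) _ (hGd η hη)
    refine ⟨fun i j => ?_, fun i j => ?_⟩
    · rw [h1, Sq_of_odd _ η hη.ne' _ _ (hoddL η hη.ne' i j)]; rfl
    · rw [h2, Sq_of_odd _ η hη.ne' _ _ (hoddR η hη.ne' i j)]; rfl
  have hXS : ∀ a, IsStieltjesPM (X a) := by
    intro a
    refine Sq_stieltjes (ν' : Measure (ℝ × BallX (Fin N ⊕ Fin n))) one_pos (fun _ : Fin 1 => a)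
      (fun _ => by rw [hm', one_apply_eq]) _ fun z _ => ?_
    simp [X]
  refine ⟨ψ, ψt, ⟨fun i => hXS _, fun j => hXS _, ?_⟩, ?_, ?_, ?_, ?_⟩
  · intro z hz
    obtain ⟨η, rfl, hη⟩ := exists_sqrt hz
    exact (sys_iff σ A ψ ψt η (hη0 η hη) (fun i => (hX η hη _).1) (fun j => (hX η hη _).1)
      (d η) (fun i => (hX η hη _).2) (fun j => (hX η hη _).2) _ (hGd η hη)).2 fun a => rfl
  · refine Sq_rep (ν : Measure (ℝ × BallX (Fin N ⊕ Fin n))) Sum.inl (fun i j => ?_) _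
      fun z hz => (hT z hz).1
    rw [hm]; simp [one_apply]
  · refine Sq_rep (ν : Measure (ℝ × BallX (Fin N ⊕ Fin n))) Sum.inr (fun i j => ?_) _
      fun z hz => (hT z hz).2
    rw [hm]; simp [one_apply]
  · refine Sq_stieltjes (ν : Measure (ℝ × BallX (Fin N ⊕ Fin n))) hN Sum.inl
      (fun _ => by rw [hm, one_apply_eq]) _ fun z hz => ?_
    simp only [trace, diag_apply, (hT z hz).1]
  · refine Sq_stieltjes (ν : Measure (ℝ × BallX (Fin N ⊕ Fin n))) hn Sum.inr
      (fun _ => by rw [hm, one_apply_eq]) _ fun z hz => ?_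
    simp only [trace, diag_apply, (hT z hz).2]

lemma main_thm (N n : ℕ) (hN : 0 < N) (hn : 0 < n)
    (σ : Fin N → Fin n → ℝ) (A : Matrix (Fin N) (Fin n) ℝ) :
    (∃ ψ ψt, SolvesSystem σ A ψ ψt)
    ∧ (∀ ψ ψt φ φt, SolvesSystem σ A ψ ψt → SolvesSystem σ A φ φt →
        ∀ z ∈ offRplus, (∀ i, ψ i z = φ i z) ∧ (∀ j, ψt j z = φt j z))
    ∧ (∀ ψ ψt, SolvesSystem σ A ψ ψt →
        HasUnitMatrixMeasureRep N (Tmat A ψ ψt)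
        ∧ HasUnitMatrixMeasureRep n (Ttmat A ψ ψt)
        ∧ IsStieltjesPM (fun z => (N : ℂ)⁻¹ * (Tmat A ψ ψt z).trace)
        ∧ IsStieltjesPM (fun z => (n : ℂ)⁻¹ * (Ttmat A ψ ψt z).trace)) := by
  obtain ⟨φ, φt, hφ, r1, r2, r3, r4⟩ := exist_full N n hN hn σ A
  refine ⟨⟨φ, φt, hφ⟩, fun ψ ψt φ φt h h' => uniq σ A ψ φ ψt φt h h', fun ψ ψt h => ?_⟩
  have hu := uniq σ A ψ φ ψt φt h hφ
  have e1 : ∀ z ∈ offRplus, Tmat A ψ ψt z = Tmat A φ φt z := by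
    intro z hz
    unfold Tmat
    simp only [(hu z hz).1, (hu z hz).2]
  have e2 : ∀ z ∈ offRplus, Ttmat A ψ ψt z = Ttmat A φ φt z := by
    intro z hz
    unfold Ttmat
    simp only [(hu z hz).1, (hu z hz).2]
  have t1 : ∀ {k : ℕ} {F F' : ℂ → Matrix (Fin k) (Fin k) ℂ}, (∀ z ∈ offRplus, F' z = F z) →
      HasUnitMatrixMeasureRep k F → HasUnitMatrixMeasureRep k F' := by
    rintro k F F' he ⟨τ, ρ, h1, h2, h3, h4, h5, h6⟩
    exact ⟨τ, ρ, h1, h2, h3, h4, h5, fun z hz => ⟨(h6 z hz).1, (he z hz).trans (h6 z hz).2⟩⟩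
  have t2 : ∀ {f f' : ℂ → ℂ}, (∀ z ∈ offRplus, f' z = f z) → IsStieltjesPM f → IsStieltjesPM f' := by
    rintro f f' he ⟨μ, h1, h2, h3⟩
    exact ⟨μ, h1, h2, fun z hz => (he z hz).trans (h3 z hz)⟩
  exact ⟨t1 e1 r1, t1 e2 r2, t2 (fun z hz => by simp only [e1 z hz]) r3,
    t2 (fun z hz => by simp only [e2 z hz]) r4⟩

end Exist

/-- Theorem 2.4: the system of `N + n` equations has a unique solution in
`S(ℝ₊)^{N+n}`; the associated `T, T̃` are represented by positive matrix-valued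
measures of total mass the identity, and their normalized traces are Stieltjes
transforms of probability measures on `ℝ₊`. -/
theorem stmt_0 (N n : ℕ) (hN : 0 < N) (hn : 0 < n)
    (σ : Fin N → Fin n → ℝ) (A : Matrix (Fin N) (Fin n) ℝ) :
    (∃ ψ ψt, SolvesSystem σ A ψ ψt)
    ∧ (∀ ψ ψt φ φt, SolvesSystem σ A ψ ψt → SolvesSystem σ A φ φt →
        ∀ z ∈ offRplus, (∀ i, ψ i z = φ i z) ∧ (∀ j, ψt j z = φt j z))
    ∧ (∀ ψ ψt, SolvesSystem σ A ψ ψt →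
        HasUnitMatrixMeasureRep N (Tmat A ψ ψt)
        ∧ HasUnitMatrixMeasureRep n (Ttmat A ψ ψt)
        ∧ IsStieltjesPM (fun z => (N : ℂ)⁻¹ * (Tmat A ψ ψt z).trace)
        ∧ IsStieltjesPM (fun z => (n : ℂ)⁻¹ * (Ttmat A ψ ψt z).trace)) := by
  exact main_thm N n hN hn σ A
end
end

section
/- For each fixed n and each σ² > 0, the deterministic quantity C̄_n(σ²) = ∫_{σ²}^{∞} (1/ω − (1/N)Tr T(−ω)) dω satisfies the closed-form expression C̄_n(σ²) = (1/N) log det[Ψ(−σ²)⁻¹/σ² + A Ψ̃(−σ²) Aᵀ] + (1/N) log det(Ψ̃(−σ²)⁻¹/σ²) − (σ²/(nN)) Σ_{i=1}^{N} Σ_{j=1}^{n} σ_ij² T_ii(−σ²) T̃_jj(−σ²). -/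
open MeasureTheory Matrix Complex Filter
open scoped Topology ComplexOrder

noncomputable section

section Core
variable {m k : Type*} [Fintype m] [DecidableEq m] [Fintype k] [DecidableEq k]

/-- The real matrix `T⁻¹`, in terms of `a = 1/(ω ψ)` and `b = 1/(ω ψ̃)`. -/
def KR (A : Matrix m k ℝ) (w : ℝ) (a : m → ℝ) (b : k → ℝ) : Matrix m m ℝ :=
  Matrix.diagonal (fun i => w * a i) + A * Matrix.diagonal (fun j => (b j)⁻¹) * Aᵀ

lemma diag_inv {K : Type*} [Field K] (a : m → K) (ha : ∀ i, a i ≠ 0) :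
    (Matrix.diagonal a)⁻¹ = Matrix.diagonal (fun i => (a i)⁻¹) := by
  apply Matrix.inv_eq_right_inv
  rw [Matrix.diagonal_mul_diagonal, ← Matrix.diagonal_one]
  congr 1
  ext i
  exact mul_inv_cancel₀ (ha i)

lemma KR_posDef (A : Matrix m k ℝ) (w : ℝ) (a : m → ℝ) (b : k → ℝ)
    (hw : 0 < w) (ha : ∀ i, 0 < a i) (hb : ∀ j, 0 < b j) : (KR A w a b).PosDef := by
  unfold KR
  apply Matrix.PosDef.add_posSemidef
  · rw [Matrix.posDef_diagonal_iff]
    intro i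
    exact mul_pos hw (ha i)
  · have h : (Matrix.diagonal (fun j => (b j)⁻¹) : Matrix k k ℝ).PosSemidef := by
      rw [Matrix.posSemidef_diagonal_iff]
      intro j
      exact (inv_pos.2 (hb j)).le
    simpa using h.mul_mul_conjTranspose_same A

lemma woodbury (A : Matrix m k ℝ) (w : ℝ) (a : m → ℝ) (b : k → ℝ)
    (hw : 0 < w) (ha : ∀ i, 0 < a i) (hb : ∀ j, 0 < b j) (i : m) :
    w * (KR A w a b)⁻¹ i i
      = (a i)⁻¹ - ((a i)⁻¹) ^ 2 * (A * (KR Aᵀ w b a)⁻¹ * Aᵀ) i i := by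
  have hX : (Matrix.diagonal (fun i => w * a i))⁻¹
      = w⁻¹ • (Matrix.diagonal (fun i => (a i)⁻¹) : Matrix m m ℝ) := by
    rw [diag_inv _ (fun i => (mul_pos hw (ha i)).ne')]
    ext i j
    by_cases h : i = j
    · subst h; simp [mul_comm]
    · simp [h]
  have hC : (Matrix.diagonal (fun j => (b j)⁻¹))⁻¹ = (Matrix.diagonal b : Matrix k k ℝ) := by
    rw [diag_inv _ (fun j => (inv_pos.2 (hb j)).ne')]
    simp
  have hK := KR_posDef Aᵀ w b a hw hb ha
  have hmid : (Matrix.diagonal b : Matrix k k ℝ)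
      + Aᵀ * (w⁻¹ • (Matrix.diagonal (fun i => (a i)⁻¹) : Matrix m m ℝ)) * A
      = w⁻¹ • KR Aᵀ w b a := by
    unfold KR
    rw [smul_add]
    congr 1
    · ext i j
      by_cases h : i = j
      · subst h; simp [hw.ne']
      · simp [h]
    · simp
  have hmidinv : (w⁻¹ • KR Aᵀ w b a)⁻¹ = w • (KR Aᵀ w b a)⁻¹ := by
    apply Matrix.inv_eq_right_inv
    rw [smul_mul_smul_comm, inv_mul_cancel₀ hw.ne', one_smul]
    exact Matrix.mul_nonsing_inv _ ((Matrix.isUnit_iff_isUnit_det _).1 hK.isUnit)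
  have key := Matrix.add_mul_mul_inv_eq_sub (Matrix.diagonal (fun i => w * a i)) A
    (Matrix.diagonal (fun j => (b j)⁻¹)) Aᵀ
    (by
      refine Matrix.PosDef.isUnit ?_
      rw [Matrix.posDef_diagonal_iff]
      exact fun i => mul_pos hw (ha i))
    (by
      refine Matrix.PosDef.isUnit ?_
      rw [Matrix.posDef_diagonal_iff]
      exact fun i => inv_pos.2 (hb i))
    (by
      rw [hX, hC, hmid]
      exact (hK.smul (inv_pos.2 hw)).isUnit)
  rw [hX, hC, hmid, hmidinv] at key
  have e : KR A w a b = Matrix.diagonal (fun i => w * a i)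
    + A * Matrix.diagonal (fun j => (b j)⁻¹) * Aᵀ := rfl
  rw [e, key]
  have e2 : w⁻¹ • Matrix.diagonal (fun i => (a i)⁻¹) * A * w • (KR Aᵀ w b a)⁻¹ * Aᵀ
      * w⁻¹ • Matrix.diagonal (fun i => (a i)⁻¹)
      = w⁻¹ • (Matrix.diagonal (fun i => (a i)⁻¹) * (A * (KR Aᵀ w b a)⁻¹ * Aᵀ)
        * Matrix.diagonal (fun i => (a i)⁻¹)) := by
    simp only [Matrix.smul_mul, Matrix.mul_smul, smul_smul, Matrix.mul_assoc]
    congr 1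
    field_simp
  rw [e2]
  simp only [Matrix.sub_apply, Matrix.smul_apply, Matrix.mul_diagonal, Matrix.diagonal_mul,
    Matrix.diagonal_apply_eq, smul_eq_mul]
  field_simp

lemma T_nonneg (A : Matrix m k ℝ) (w : ℝ) (a : m → ℝ) (b : k → ℝ)
    (hw : 0 < w) (ha : ∀ i, 0 < a i) (hb : ∀ j, 0 < b j) (i : m) :
    0 ≤ (KR A w a b)⁻¹ i i :=
  (KR_posDef A w a b hw ha hb).inv.posSemidef.diag_nonneg

lemma T_le (A : Matrix m k ℝ) (w : ℝ) (a : m → ℝ) (b : k → ℝ)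
    (hw : 0 < w) (ha : ∀ i, 0 < a i) (hb : ∀ j, 0 < b j) (i : m) :
    w * (KR A w a b)⁻¹ i i ≤ (a i)⁻¹ := by
  rw [woodbury A w a b hw ha hb]
  have h := ((KR_posDef Aᵀ w b a hw hb ha).inv.posSemidef.mul_mul_conjTranspose_same A).diag_nonneg
    (i := i)
  rw [Matrix.conjTranspose_eq_transpose_of_trivial] at h
  have := mul_nonneg (sq_nonneg (a i)⁻¹) h
  linarith

/-- Jacobi's formula. -/
lemma hasDerivAt_det (M : ℝ → Matrix m m ℝ) (M' : Matrix m m ℝ) (x : ℝ)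
    (hM : ∀ i j, HasDerivAt (fun w => M w i j) (M' i j) x) :
    HasDerivAt (fun w => (M w).det) (((M x).adjugate * M').trace) x := by
  let D : ContinuousMultilinearMap ℝ (fun _ : m => m → ℝ) ℝ :=
    ⟨(Matrix.detRowAlternating : (m → ℝ) [⋀^m]→ₗ[ℝ] ℝ).toMultilinearMap, by
      change Continuous fun M : Matrix m m ℝ => M.det
      fun_prop⟩
  have h1 : HasDerivAt (fun w => (fun i => M w i : m → m → ℝ)) (fun i => M' i) x := by
    rw [hasDerivAt_pi]; intro i
    rw [hasDerivAt_pi]; intro j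
    exact hM i j
  have h2 := (D.hasFDerivAt (fun i => M x i)).comp_hasDerivAt x h1
  refine h2.congr_deriv ?_
  rw [ContinuousMultilinearMap.linearDeriv_apply]
  rw [Matrix.trace_mul_comm]
  simp only [Matrix.trace, Matrix.diag_apply, Matrix.mul_apply]
  refine Finset.sum_congr rfl fun i _ => ?_
  change ((M x).updateRow i (M' i)).det = _
  simp_rw [Matrix.adjugate_apply]
  have hs : M' i = ∑ j, M' i j • (Pi.single j (1:ℝ) : m → ℝ) := by
    ext l; simp [Finset.sum_apply, Pi.single_apply]
  conv_lhs => rw [hs]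
  have := (Matrix.detRowAlternating : (m → ℝ) [⋀^m]→ₗ[ℝ] ℝ).toMultilinearMap.map_update_sum
    (t := Finset.univ) i (fun j => M' i j • (Pi.single j (1:ℝ) : m → ℝ)) (M x)
  refine this.trans ?_
  refine Finset.sum_congr rfl fun j _ => ?_
  exact Matrix.det_updateRow_smul (M x) i (M' i j) _

lemma matInv_differentiableAt (M : ℝ → Matrix m m ℝ) (x : ℝ)
    (hM : ∀ i j, DifferentiableAt ℝ (fun w => M w i j) x) (hx : (M x).det ≠ 0) (i j : m) :
    DifferentiableAt ℝ (fun w => (M w)⁻¹ i j) x := by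
  have hdet : ∀ (P : ℝ → Matrix m m ℝ), (∀ i j, DifferentiableAt ℝ (fun w => P w i j) x) →
      DifferentiableAt ℝ (fun w => (P w).det) x := fun P hP =>
    (hasDerivAt_det P (fun i j => deriv (fun w => P w i j) x) x
      (fun i j => (hP i j).hasDerivAt)).differentiableAt
  have e : (fun w => (M w)⁻¹ i j) = fun w => ((M w).det)⁻¹ * ((M w).updateRow j (Pi.single i 1)).det := by
    ext w
    rw [Matrix.inv_def, Ring.inverse_eq_inv', Matrix.smul_apply, Matrix.adjugate_apply, smul_eq_mul]
  rw [e]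
  refine ((hdet M hM).inv hx).mul (hdet _ fun p q => ?_)
  by_cases h : p = j
  · subst h; simp
  · simpa [Matrix.updateRow_ne h] using hM p q

lemma conj_apply {R : Type*} [CommSemiring R] (A : Matrix m k R) (d : k → R) (i j : m) :
    (A * Matrix.diagonal d * Aᵀ) i j = ∑ l, A i l * d l * A j l := by
  rw [Matrix.mul_apply]
  simp only [Matrix.mul_diagonal, Matrix.transpose_apply]

lemma KR_apply (A : Matrix m k ℝ) (w : ℝ) (a : m → ℝ) (b : k → ℝ) (i j : m) :
    KR A w a b i j = (if i = j then w * a i else 0) + ∑ l, A i l * (b l)⁻¹ * A j l := by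
  rw [KR, Matrix.add_apply, Matrix.diagonal_apply, conj_apply]

lemma KR_hasDerivAt (A : Matrix m k ℝ) (a : m → ℝ → ℝ) (b : k → ℝ → ℝ) (a' : m → ℝ) (b' : k → ℝ)
    (x : ℝ) (ha : ∀ i, HasDerivAt (a i) (a' i) x) (hb : ∀ j, HasDerivAt (b j) (b' j) x)
    (hbx : ∀ j, b j x ≠ 0) (i j : m) :
    HasDerivAt (fun w => KR A w (fun i => a i w) (fun j => b j w) i j)
      ((Matrix.diagonal (fun i => a i x + x * a' i)
        - A * Matrix.diagonal (fun j => b' j / b j x ^ 2) * Aᵀ) i j) x := by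
  simp_rw [KR_apply]
  have h1 : HasDerivAt (fun w => if i = j then w * a i w else 0)
      (if i = j then a i x + x * a' i else 0) x := by
    by_cases h : i = j
    · simp only [h, if_true]
      simpa using (hasDerivAt_id' x).fun_mul (ha j)
    · simp only [h, if_false]
      exact hasDerivAt_const x 0
  have h2 : HasDerivAt (fun w => ∑ l, A i l * (b l w)⁻¹ * A j l)
      (∑ l, A i l * (-(b' l) / b l x ^ 2) * A j l) x := by
    apply HasDerivAt.fun_sum
    intro l _
    exact (((hb l).inv (hbx l)).const_mul (A i l)).mul_const (A j l)
  refine (h1.add h2).congr_deriv ?_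
  rw [Matrix.sub_apply, Matrix.diagonal_apply, conj_apply, sub_eq_add_neg,
    ← Finset.sum_neg_distrib]
  congr 1
  refine Finset.sum_congr rfl fun l _ => ?_
  ring

/-- the closed form, times `N` -/
def VR (A : Matrix m k ℝ) (s : m → k → ℝ) (c : ℝ) (a : m → ℝ → ℝ) (b : k → ℝ → ℝ) (w : ℝ) : ℝ :=
  Real.log (KR A w (fun i => a i w) (fun j => b j w)).det - Fintype.card m * Real.log w
    + ∑ j, Real.log (b j w)
    - w * (c * ∑ i, ∑ j, s i j * (KR A w (fun i => a i w) (fun j => b j w))⁻¹ i i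
        * (KR Aᵀ w (fun j => b j w) (fun i => a i w))⁻¹ j j)

lemma logdet_hasDerivAt (A : Matrix m k ℝ) (a : m → ℝ → ℝ) (b : k → ℝ → ℝ)
    (a' : m → ℝ) (b' : k → ℝ)
    (x : ℝ) (hx : 0 < x)
    (ha : ∀ i, HasDerivAt (a i) (a' i) x) (hb : ∀ j, HasDerivAt (b j) (b' j) x)
    (hapos : ∀ i, 0 < a i x) (hbpos : ∀ j, 0 < b j x) :
    HasDerivAt (fun w => Real.log (KR A w (fun i => a i w) (fun j => b j w)).det
        + ∑ j, Real.log (b j w))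
      (∑ i, (KR A x (fun i => a i x) (fun j => b j x))⁻¹ i i * (a i x + x * a' i)
        + ∑ j, x * (KR Aᵀ x (fun j => b j x) (fun i => a i x))⁻¹ j j * b' j) x := by
  set K := KR A x (fun i => a i x) (fun j => b j x) with hK
  have hpd : K.PosDef := KR_posDef A x _ _ hx hapos hbpos
  have hdet := hpd.det_pos
  have h1 := (hasDerivAt_det _ _ x (KR_hasDerivAt A a b a' b' x ha hb
    (fun j => (hbpos j).ne'))).log hdet.ne'
  have h2 : HasDerivAt (fun w => ∑ j, Real.log (b j w)) (∑ j, b' j / b j x) x := by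
    apply HasDerivAt.fun_sum
    intro j _
    exact (hb j).log (hbpos j).ne'
  refine (h1.add h2).congr_deriv ?_
  rw [← hK]
  have e1 : ∀ P : Matrix m m ℝ, (K.adjugate * P).trace / K.det = (K⁻¹ * P).trace := by
    intro P
    rw [Matrix.inv_def, Ring.inverse_eq_inv', Matrix.smul_mul, Matrix.trace_smul, smul_eq_mul]
    field_simp
  rw [e1, Matrix.mul_sub, Matrix.trace_sub]
  have e2 : (K⁻¹ * Matrix.diagonal (fun i => a i x + x * a' i)).trace
      = ∑ i, K⁻¹ i i * (a i x + x * a' i) := by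
    simp [Matrix.trace, Matrix.mul_diagonal]
  have e3 : (K⁻¹ * (A * Matrix.diagonal (fun j => b' j / b j x ^ 2) * Aᵀ)).trace
      = ∑ j, (Aᵀ * K⁻¹ * A) j j * (b' j / b j x ^ 2) := by
    rw [← Matrix.mul_assoc, Matrix.trace_mul_comm, ← Matrix.mul_assoc, ← Matrix.mul_assoc]
    simp [Matrix.trace, Matrix.mul_diagonal]
  rw [e2, e3, add_comm_sub, add_sub_assoc', add_sub_assoc, ← Finset.sum_sub_distrib]
  congr 1
  refine Finset.sum_congr rfl fun j _ => ?_
  rw [woodbury Aᵀ x _ _ hx hbpos hapos j]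
  simp only [Matrix.transpose_transpose, ← hK]
  have := (hbpos j).ne'
  field_simp

structure Sys (A : Matrix m k ℝ) (s : m → k → ℝ) (c : ℝ) (a : m → ℝ → ℝ) (b : k → ℝ → ℝ) :
    Prop where
  hs : ∀ i j, 0 ≤ s i j
  hc : 0 ≤ c
  da : ∀ i w, 0 < w → DifferentiableAt ℝ (a i) w
  db : ∀ j w, 0 < w → DifferentiableAt ℝ (b j) w
  pa : ∀ i w, 0 < w → 0 < a i w
  pb : ∀ j w, 0 < w → 0 < b j w
  ea : ∀ i w, 0 < w →
    a i w = 1 + c * ∑ j, s i j * (KR Aᵀ w (fun j => b j w) (fun i => a i w))⁻¹ j j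
  eb : ∀ j w, 0 < w →
    b j w = 1 + c * ∑ i, s i j * (KR A w (fun i => a i w) (fun j => b j w))⁻¹ i i

lemma Sys.symm {A : Matrix m k ℝ} {s : m → k → ℝ} {c : ℝ} {a : m → ℝ → ℝ} {b : k → ℝ → ℝ}
    (h : Sys A s c a b) : Sys Aᵀ (fun j i => s i j) c b a where
  hs i j := h.hs j i
  hc := h.hc
  da := h.db
  db := h.da
  pa := h.pb
  pb := h.pa
  ea := by simpa using h.eb
  eb := by simpa using h.ea

lemma Sys.one_le {A : Matrix m k ℝ} {s : m → k → ℝ} {c : ℝ} {a : m → ℝ → ℝ} {b : k → ℝ → ℝ}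
    (h : Sys A s c a b) (i : m) (w : ℝ) (hw : 0 < w) : 1 ≤ a i w := by
  rw [h.ea i w hw]
  have : 0 ≤ c * ∑ j, s i j * (KR Aᵀ w (fun j => b j w) (fun i => a i w))⁻¹ j j :=
    mul_nonneg h.hc (Finset.sum_nonneg fun j _ => mul_nonneg (h.hs i j)
      (T_nonneg Aᵀ w _ _ hw (fun j => h.pb j w hw) (fun i => h.pa i w hw) j))
  linarith

lemma Sys.wT_le {A : Matrix m k ℝ} {s : m → k → ℝ} {c : ℝ} {a : m → ℝ → ℝ} {b : k → ℝ → ℝ}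
    (h : Sys A s c a b) (i : m) (w : ℝ) (hw : 0 < w) :
    w * (KR A w (fun i => a i w) (fun j => b j w))⁻¹ i i ≤ 1 :=
  (T_le A w _ _ hw (fun i => h.pa i w hw) (fun j => h.pb j w hw) i).trans
    (inv_le_one_of_one_le₀ (h.one_le i w hw))

lemma Sys.T_tendsto {A : Matrix m k ℝ} {s : m → k → ℝ} {c : ℝ} {a : m → ℝ → ℝ} {b : k → ℝ → ℝ}
    (h : Sys A s c a b) (i : m) :
    Tendsto (fun w => (KR A w (fun i => a i w) (fun j => b j w))⁻¹ i i) atTop (𝓝 0) := by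
  refine squeeze_zero' (g := fun w => w⁻¹) ?_ ?_ tendsto_inv_atTop_zero
  · filter_upwards [eventually_gt_atTop 0] with w hw
    exact T_nonneg A w _ _ hw (fun i => h.pa i w hw) (fun j => h.pb j w hw) i
  · filter_upwards [eventually_gt_atTop 0] with w hw
    rw [← one_div w, le_div_iff₀ hw, mul_comm]
    exact h.wT_le i w hw

lemma Sys.b_tendsto {A : Matrix m k ℝ} {s : m → k → ℝ} {c : ℝ} {a : m → ℝ → ℝ} {b : k → ℝ → ℝ}
    (h : Sys A s c a b) (j : k) : Tendsto (b j) atTop (𝓝 1) := by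
  have : Tendsto (fun w => 1 + c * ∑ i, s i j *
      (KR A w (fun i => a i w) (fun j => b j w))⁻¹ i i) atTop (𝓝 (1 + c * ∑ i, s i j * 0)) :=
    tendsto_const_nhds.add (tendsto_const_nhds.mul (tendsto_finsetSum _ fun i _ =>
      tendsto_const_nhds.mul (h.T_tendsto i)))
  simp only [mul_zero, Finset.sum_const_zero, add_zero] at this
  refine this.congr' ?_
  filter_upwards [eventually_gt_atTop 0] with w hw
  exact (h.eb j w hw).symm

lemma Sys.V_tendsto {A : Matrix m k ℝ} {s : m → k → ℝ} {c : ℝ} {a : m → ℝ → ℝ} {b : k → ℝ → ℝ}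
    (h : Sys A s c a b) : Tendsto (VR A s c a b) atTop (𝓝 0) := by
  have h1 : Tendsto (fun w => Real.log (KR A w (fun i => a i w) (fun j => b j w)).det
      - Fintype.card m * Real.log w) atTop (𝓝 0) := by
    have hM : Tendsto (fun w => (w⁻¹ • KR A w (fun i => a i w) (fun j => b j w))) atTop
        (𝓝 (1 : Matrix m m ℝ)) := by
      refine tendsto_pi_nhds.2 fun i => tendsto_pi_nhds.2 fun j => ?_
      have e : Tendsto (fun w => (if i = j then a i w else 0)
          + w⁻¹ * ∑ l, A i l * (b l w)⁻¹ * A j l) atTop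
          (𝓝 ((if i = j then 1 else 0) + 0 * ∑ l, A i l * (1:ℝ)⁻¹ * A j l)) := by
        refine Tendsto.add ?_ (tendsto_inv_atTop_zero.mul (tendsto_finsetSum _ fun l _ =>
          (tendsto_const_nhds.mul ((h.b_tendsto l).inv₀ one_ne_zero)).mul tendsto_const_nhds))
        by_cases hij : i = j
        · simpa only [hij, if_true] using h.symm.b_tendsto j
        · simp only [hij, if_false]; exact tendsto_const_nhds
      rw [zero_mul, add_zero] at e
      rw [Matrix.one_apply]
      refine e.congr' ?_
      filter_upwards [eventually_gt_atTop 0] with w hw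
      rw [Matrix.smul_apply, KR_apply, smul_eq_mul, mul_add]
      congr 1
      split_ifs
      · field_simp
      · simp
    have hd : Tendsto (fun w => (w⁻¹ • KR A w (fun i => a i w) (fun j => b j w)).det) atTop
        (𝓝 (1 : Matrix m m ℝ).det) :=
      ((Continuous.matrix_det continuous_id).tendsto (1 : Matrix m m ℝ)).comp hM
    rw [Matrix.det_one] at hd
    have hl := hd.log one_ne_zero
    rw [Real.log_one] at hl
    refine hl.congr' ?_
    filter_upwards [eventually_gt_atTop 0] with w hw
    have hp := (KR_posDef A w _ _ hw (fun i => h.pa i w hw) (fun j => h.pb j w hw)).det_pos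
    rw [Matrix.det_smul, Real.log_mul (pow_pos (inv_pos.2 hw) _).ne' hp.ne', Real.log_pow,
      Real.log_inv]
    ring
  have h2 : Tendsto (fun w => ∑ j, Real.log (b j w)) atTop (𝓝 (∑ j : k, Real.log 1)) :=
    tendsto_finsetSum _ fun j _ => (h.b_tendsto j).log one_ne_zero
  have h3 : Tendsto (fun w => w * (c * ∑ i, ∑ j, s i j *
      (KR A w (fun i => a i w) (fun j => b j w))⁻¹ i i
        * (KR Aᵀ w (fun j => b j w) (fun i => a i w))⁻¹ j j)) atTop (𝓝 0) := by
    have hz : Tendsto (fun w => c * ∑ i, ∑ j, s i j *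
        (KR Aᵀ w (fun j => b j w) (fun i => a i w))⁻¹ j j) atTop
        (𝓝 (c * ∑ i, ∑ j, s i j * 0)) :=
      tendsto_const_nhds.mul (tendsto_finsetSum _ fun i _ => tendsto_finsetSum _ fun j _ =>
        tendsto_const_nhds.mul (h.symm.T_tendsto j))
    simp only [mul_zero, Finset.sum_const_zero] at hz
    have hT : ∀ i w, 0 < w → 0 ≤ (KR A w (fun i => a i w) (fun j => b j w))⁻¹ i i :=
      fun i w hw => T_nonneg A w _ _ hw (fun i => h.pa i w hw) (fun j => h.pb j w hw) i
    have hTt : ∀ j w, 0 < w → 0 ≤ (KR Aᵀ w (fun j => b j w) (fun i => a i w))⁻¹ j j :=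
      fun j w hw => T_nonneg Aᵀ w _ _ hw (fun j => h.pb j w hw) (fun i => h.pa i w hw) j
    refine squeeze_zero' ?_ ?_ hz
    · filter_upwards [eventually_gt_atTop 0] with w hw
      refine mul_nonneg hw.le (mul_nonneg h.hc (Finset.sum_nonneg fun i _ =>
        Finset.sum_nonneg fun j _ => mul_nonneg (mul_nonneg (h.hs i j) (hT i w hw)) (hTt j w hw)))
    · filter_upwards [eventually_gt_atTop 0] with w hw
      rw [mul_left_comm]
      refine mul_le_mul_of_nonneg_left ?_ h.hc
      rw [Finset.mul_sum]
      refine Finset.sum_le_sum fun i _ => ?_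
      rw [Finset.mul_sum]
      refine Finset.sum_le_sum fun j _ => ?_
      have := mul_le_mul_of_nonneg_right (h.wT_le i w hw) (mul_nonneg (h.hs i j) (hTt j w hw))
      linarith
  have := (h1.add h2).sub h3
  simp only [Real.log_one, Finset.sum_const_zero, add_zero, sub_zero] at this
  exact this

lemma Sys.V_hasDerivAt {A : Matrix m k ℝ} {s : m → k → ℝ} {c : ℝ} {a : m → ℝ → ℝ} {b : k → ℝ → ℝ}
    (h : Sys A s c a b) (x : ℝ) (hx : 0 < x) : HasDerivAt (VR A s c a b)
      (-(Fintype.card m * x⁻¹ - ((KR A x (fun i => a i x) (fun j => b j x))⁻¹).trace)) x := by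
  obtain ⟨a', ha'⟩ : ∃ a' : m → ℝ, ∀ i, HasDerivAt (a i) (a' i) x :=
    ⟨_, fun i => (h.da i x hx).hasDerivAt⟩
  obtain ⟨b', hb'⟩ : ∃ b' : k → ℝ, ∀ j, HasDerivAt (b j) (b' j) x :=
    ⟨_, fun j => (h.db j x hx).hasDerivAt⟩
  have hpa : ∀ i, 0 < a i x := fun i => h.pa i x hx
  have hpb : ∀ j, 0 < b j x := fun j => h.pb j x hx
  obtain ⟨t', ht'⟩ : ∃ t' : m → ℝ, ∀ i, HasDerivAt
      (fun w => (KR A w (fun i => a i w) (fun j => b j w))⁻¹ i i) (t' i) x :=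
    ⟨_, fun i => (matInv_differentiableAt _ x (fun i j => (KR_hasDerivAt A a b a' b' x ha' hb'
      (fun j => (hpb j).ne') i j).differentiableAt)
      (KR_posDef A x _ _ hx hpa hpb).det_pos.ne' i i).hasDerivAt⟩
  obtain ⟨u', hu'⟩ : ∃ u' : k → ℝ, ∀ j, HasDerivAt
      (fun w => (KR Aᵀ w (fun j => b j w) (fun i => a i w))⁻¹ j j) (u' j) x :=
    ⟨_, fun j => (matInv_differentiableAt _ x (fun i j => (KR_hasDerivAt Aᵀ b a b' a' x hb' ha'
      (fun j => (hpa j).ne') i j).differentiableAt)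
      (KR_posDef Aᵀ x _ _ hx hpb hpa).det_pos.ne' j j).hasDerivAt⟩
  have hev : ∀ᶠ w in 𝓝 x, 0 < w := lt_mem_nhds hx
  have ea' : ∀ i, a' i = c * ∑ j, s i j * u' j := by
    intro i
    have h1 : HasDerivAt (fun w => 1 + c * ∑ j, s i j *
        (KR Aᵀ w (fun j => b j w) (fun i => a i w))⁻¹ j j) (c * ∑ j, s i j * u' j) x :=
      ((HasDerivAt.fun_sum fun j _ => (hu' j).const_mul (s i j)).const_mul c).const_add 1
    exact (ha' i).unique (h1.congr_of_eventuallyEq (hev.mono fun w hw => h.ea i w hw))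
  have eb' : ∀ j, b' j = c * ∑ i, s i j * t' i := by
    intro j
    have h1 : HasDerivAt (fun w => 1 + c * ∑ i, s i j *
        (KR A w (fun i => a i w) (fun j => b j w))⁻¹ i i) (c * ∑ i, s i j * t' i) x :=
      ((HasDerivAt.fun_sum fun i _ => (ht' i).const_mul (s i j)).const_mul c).const_add 1
    exact (hb' j).unique (h1.congr_of_eventuallyEq (hev.mono fun w hw => h.eb j w hw))
  have hL := logdet_hasDerivAt A a b a' b' x hx ha' hb' hpa hpb
  have hlog := (Real.hasDerivAt_log hx.ne').const_mul (Fintype.card m : ℝ)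
  have hS := (hasDerivAt_id' x).fun_mul ((HasDerivAt.fun_sum (u := Finset.univ) fun i _ =>
    HasDerivAt.fun_sum (u := Finset.univ) fun j _ =>
      ((ht' i).const_mul (s i j)).fun_mul (hu' j)).const_mul c)
  have hV := (hL.fun_sub hlog).fun_sub hS
  have hVe : VR A s c a b = fun w => (Real.log (KR A w (fun i => a i w) (fun j => b j w)).det
        + ∑ j, Real.log (b j w)) - Fintype.card m * Real.log w
        - w * (c * ∑ i, ∑ j, s i j * (KR A w (fun i => a i w) (fun j => b j w))⁻¹ i i
        * (KR Aᵀ w (fun j => b j w) (fun i => a i w))⁻¹ j j) := by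
    ext w; unfold VR; ring
  rw [hVe]
  refine HasDerivAt.congr_deriv hV ?_
  have eax : ∀ i, a i x = 1 + c * ∑ j, s i j *
      (KR Aᵀ x (fun j => b j x) (fun i => a i x))⁻¹ j j := fun i => h.ea i x hx
  generalize hT : (KR A x (fun i => a i x) (fun j => b j x))⁻¹ = T at *
  generalize hTt : (KR Aᵀ x (fun j => b j x) (fun i => a i x))⁻¹ = Tt at *
  simp only [Matrix.trace, Matrix.diag_apply, id]
  have r1 : ∑ i, T i i * (a i x + x * a' i) = ∑ i, T i i
      + c * ∑ i, ∑ j, s i j * T i i * Tt j j + x * (c * ∑ i, ∑ j, s i j * T i i * u' j) := by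
    simp only [Finset.mul_sum]
    rw [← Finset.sum_add_distrib, ← Finset.sum_add_distrib]
    refine Finset.sum_congr rfl fun i _ => ?_
    rw [eax i, ea' i, mul_add, mul_add, mul_one]
    congr 1
    · congr 1
      simp only [Finset.mul_sum]
      exact Finset.sum_congr rfl fun j _ => by ring
    · simp only [Finset.mul_sum]
      exact Finset.sum_congr rfl fun j _ => by ring
  have r2 : ∑ j, x * Tt j j * b' j = x * (c * ∑ i, ∑ j, s i j * t' i * Tt j j) := by
    rw [Finset.sum_comm]
    simp only [Finset.mul_sum]
    refine Finset.sum_congr rfl fun j _ => ?_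
    rw [eb' j]
    simp only [Finset.mul_sum]
    exact Finset.sum_congr rfl fun j _ => by ring
  rw [r1, r2]
  simp only [Finset.sum_add_distrib]
  ring

lemma Sys.integral_eq {A : Matrix m k ℝ} {s : m → k → ℝ} {c : ℝ} {a : m → ℝ → ℝ} {b : k → ℝ → ℝ}
    (h : Sys A s c a b) (x : ℝ) (hx : 0 < x) :
    ∫ w in Set.Ioi x, (Fintype.card m * w⁻¹
      - ((KR A w (fun i => a i w) (fun j => b j w))⁻¹).trace) = VR A s c a b x := by
  have h1 := integral_Ioi_of_hasDerivAt_of_nonpos' (a := x)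
    (fun w (hw : x ≤ w) => h.V_hasDerivAt w (hx.trans_le hw)) (fun w (hw : x < w) => by
      have hw0 := hx.trans hw
      have : ((KR A w (fun i => a i w) (fun j => b j w))⁻¹).trace ≤ ∑ _i : m, w⁻¹ := by
        refine Finset.sum_le_sum fun i _ => ?_
        rw [← one_div w, le_div_iff₀ hw0, mul_comm]
        exact h.wT_le i w hw0
      simp only [Finset.sum_const, Finset.card_univ, nsmul_eq_mul] at this
      linarith) h.V_tendsto
  rw [integral_neg] at h1
  linarith

end Core

lemma stieltjes_real (f : ℂ → ℂ) (hf : IsStieltjesPM f) :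
    ∃ p : ℝ → ℝ, ∀ w : ℝ, 0 < w → f (-(w : ℂ)) = p w ∧ 0 < p w ∧ DifferentiableAt ℝ p w := by
  obtain ⟨μ, hμ, hμ0, hfz⟩ := hf
  have hae : ∀ᵐ t ∂μ, 0 ≤ t := by
    rw [ae_iff]
    simpa [Set.Iio] using hμ0
  have hint : ∀ w : ℝ, 0 < w → Integrable (fun t : ℝ => (t + w)⁻¹) μ := by
    intro w hw
    refine Integrable.of_bound (C := w⁻¹) (by fun_prop) ?_
    filter_upwards [hae] with t ht
    rw [Real.norm_of_nonneg (by positivity)]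
    gcongr
    linarith
  refine ⟨fun w => ∫ t, (t + w)⁻¹ ∂μ, fun w hw => ⟨?_, ?_, ?_⟩⟩
  · rw [hfz _ (by simp [offRplus, hw])]
    refine Eq.trans ?_ (integral_ofReal (𝕜 := ℂ) (f := fun t : ℝ => (t + w)⁻¹))
    refine integral_congr_ae (Eventually.of_forall fun t => ?_)
    simp
  · rw [integral_pos_iff_support_of_nonneg_ae _ (hint w hw)]
    · have h1 : μ (Function.support fun t : ℝ => (t + w)⁻¹) = 1 := by
        rw [← measure_univ (μ := μ)]
        apply measure_congr
        filter_upwards [hae] with t ht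
        have : t + w ≠ 0 := by positivity
        apply propext
        change ((t + w)⁻¹ ≠ 0) ↔ True
        simp [this]
      rw [h1]
      exact one_pos
    · filter_upwards [hae] with t ht
      simp only [Pi.zero_apply]
      positivity
  · have := hasDerivAt_integral_of_dominated_loc_of_deriv_le (μ := μ) (𝕜 := ℝ)
      (F := fun w t => (t + w)⁻¹) (F' := fun w t => -1 / (t + w) ^ 2) (x₀ := w)
      (s := Set.Ioi (w / 2)) (bound := fun _ => 1 / (w / 2) ^ 2)
      (Ioi_mem_nhds (by linarith)) (Eventually.of_forall fun x => by fun_prop) (hint w hw)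
      (Measurable.aestronglyMeasurable (by fun_prop)) ?_ (integrable_const _) ?_
    · exact this.2.differentiableAt
    · filter_upwards [hae] with t ht x hx
      have hx' : w / 2 < x := hx
      have : 0 < w / 2 := by linarith
      rw [norm_div, norm_neg, norm_one, Real.norm_of_nonneg (by positivity)]
      gcongr
      linarith
    · filter_upwards [hae] with t ht x hx
      have hx' : w / 2 < x := hx
      have h0 : t + x ≠ 0 := by
        have : 0 < t + x := by linarith
        exact this.ne'
      exact ((hasDerivAt_id' x).const_add t).inv h0

lemma inner_eq {N n : ℕ} (A : Matrix (Fin N) (Fin n) ℝ) (ψ : Fin N → ℂ) (ψt : Fin n → ℂ)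
    (w : ℝ) (hw : 0 < w) (p : Fin N → ℝ) (q : Fin n → ℝ) (hp : ∀ i, ψ i = p i)
    (hq : ∀ j, ψt j = q j) (hp0 : ∀ i, 0 < p i) :
    (Matrix.diagonal ψ)⁻¹
      + (w : ℂ) • (A.map Complex.ofReal * Matrix.diagonal ψt * (A.map Complex.ofReal)ᵀ)
    = (KR A w (fun i => (w * p i)⁻¹) (fun j => (w * q j)⁻¹)).map Complex.ofReal := by
  have hψ : ∀ i, ψ i ≠ 0 := fun i => by
    rw [hp]; exact_mod_cast (hp0 i).ne'
  rw [diag_inv _ hψ]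
  ext i j
  rw [Matrix.map_apply, KR_apply, Matrix.add_apply, Matrix.smul_apply, conj_apply,
    Matrix.diagonal_apply, Complex.ofReal_add, Complex.ofReal_sum, smul_eq_mul, Finset.mul_sum]
  congr 1
  · split_ifs
    · rw [hp, ← Complex.ofReal_inv]
      congr 1
      have := (hp0 i).ne'
      field_simp
    · simp
  · refine Finset.sum_congr rfl fun l _ => ?_
    rw [hq, inv_inv]
    simp only [Matrix.map_apply]
    push_cast
    ring

lemma Tmat_eq {N n : ℕ} (A : Matrix (Fin N) (Fin n) ℝ) (ψ : Fin N → ℂ → ℂ) (ψt : Fin n → ℂ → ℂ)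
    (w : ℝ) (hw : 0 < w) (p : Fin N → ℝ) (q : Fin n → ℝ) (hp : ∀ i, ψ i (-(w : ℂ)) = p i)
    (hq : ∀ j, ψt j (-(w : ℂ)) = q j) (hp0 : ∀ i, 0 < p i) (hq0 : ∀ j, 0 < q j) :
    Tmat A ψ ψt (-(w : ℂ))
      = ((KR A w (fun i => (w * p i)⁻¹) (fun j => (w * q j)⁻¹))⁻¹).map Complex.ofReal := by
  unfold Tmat
  rw [neg_smul, sub_neg_eq_add, inner_eq A _ _ w hw p q hp hq hp0]
  apply Matrix.inv_eq_right_inv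
  have hpd := KR_posDef A w (fun i => (w * p i)⁻¹) (fun j => (w * q j)⁻¹) hw
    (fun i => inv_pos.2 (mul_pos hw (hp0 i))) (fun j => inv_pos.2 (mul_pos hw (hq0 j)))
  have h1 := Matrix.mul_nonsing_inv _ ((Matrix.isUnit_iff_isUnit_det _).1 hpd.isUnit)
  have h2 := congrArg (fun M : Matrix (Fin N) (Fin N) ℝ => M.map Complex.ofRealHom) h1
  simp only [Matrix.map_mul] at h2
  refine Eq.trans h2 ?_
  exact Matrix.map_one _ (map_zero _) (map_one _)

/-- Formula (4.3): the closed-form expression of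
`C̄_n(σ²) = ∫_{σ²}^∞ (1/ω - N⁻¹ Tr T(-ω)) dω`. -/
theorem stmt_4 (N n : ℕ) (hN : 0 < N) (hn : 0 < n)
    (σ : Fin N → Fin n → ℝ) (A : Matrix (Fin N) (Fin n) ℝ)
    (ψ : Fin N → ℂ → ℂ) (ψt : Fin n → ℂ → ℂ)
    (hsol : SolvesSystem σ A ψ ψt)
    (s2 : ℝ) (hs2 : 0 < s2) :
    ((∫ ω in Set.Ioi s2,
        (ω⁻¹ - (N : ℝ)⁻¹ * ((Tmat A ψ ψt (-(ω : ℂ))).trace).re) : ℝ) : ℂ)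
      = (N : ℂ)⁻¹ * Complex.log (Matrix.det
          ((s2 : ℂ)⁻¹ • (Matrix.diagonal fun i => ψ i (-(s2 : ℂ)))⁻¹
            + A.map Complex.ofReal * Matrix.diagonal (fun j => ψt j (-(s2 : ℂ)))
              * (A.map Complex.ofReal)ᵀ))
        + (N : ℂ)⁻¹ * Complex.log (Matrix.det
            ((s2 : ℂ)⁻¹ • (Matrix.diagonal fun j => ψt j (-(s2 : ℂ)))⁻¹))
        - (s2 : ℂ) / ((n : ℂ) * (N : ℂ))
          * ∑ i : Fin N, ∑ j : Fin n, ((σ i j : ℂ))^2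
              * Tmat A ψ ψt (-(s2 : ℂ)) i i * Ttmat A ψ ψt (-(s2 : ℂ)) j j := by
  obtain ⟨h1, h2, h3⟩ := hsol
  choose p hp using fun i => stieltjes_real _ (h1 i)
  choose q hq using fun j => stieltjes_real _ (h2 j)
  set a : Fin N → ℝ → ℝ := fun i w => (w * p i w)⁻¹ with ha
  set b : Fin n → ℝ → ℝ := fun j w => (w * q j w)⁻¹ with hb
  have hT : ∀ w : ℝ, 0 < w → Tmat A ψ ψt (-(w : ℂ))
      = ((KR A w (fun i => a i w) (fun j => b j w))⁻¹).map Complex.ofReal := fun w hw =>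
    Tmat_eq A ψ ψt w hw (fun i => p i w) (fun j => q j w) (fun i => (hp i w hw).1)
      (fun j => (hq j w hw).1) (fun i => (hp i w hw).2.1) (fun j => (hq j w hw).2.1)
  have hTt : ∀ w : ℝ, 0 < w → Ttmat A ψ ψt (-(w : ℂ))
      = ((KR Aᵀ w (fun j => b j w) (fun i => a i w))⁻¹).map Complex.ofReal := fun w hw =>
    Tmat_eq Aᵀ ψt ψ w hw (fun j => q j w) (fun i => p i w) (fun j => (hq j w hw).1)
      (fun i => (hp i w hw).1) (fun j => (hq j w hw).2.1) (fun i => (hp i w hw).2.1)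
  have hoff : ∀ w : ℝ, 0 < w → (-(w : ℂ)) ∈ offRplus := fun w hw => by simp [offRplus, hw]
  have hpa : ∀ i w, 0 < w → 0 < a i w := fun i w hw => inv_pos.2 (mul_pos hw (hp i w hw).2.1)
  have hpb : ∀ j w, 0 < w → 0 < b j w := fun j w hw => inv_pos.2 (mul_pos hw (hq j w hw).2.1)
  have aux : ∀ (w : ℝ) (P : ℝ) (X : ℂ) (Y : ℝ), 0 < w → X = Y →
      (P : ℂ) = -(-(w : ℂ) * (1 + X))⁻¹ → (w * P)⁻¹ = 1 + Y := by
    intro w P X Y hw hXY hP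
    rw [hXY] at hP
    have hP' : P = (w * (1 + Y))⁻¹ := by
      rw [neg_mul, inv_neg, neg_neg] at hP
      exact_mod_cast hP
    rw [hP', mul_inv, inv_inv, inv_mul_cancel_left₀ hw.ne']
  have hsys : Sys A (fun i j => σ i j ^ 2) (n : ℝ)⁻¹ a b :=
    { hs := fun i j => sq_nonneg _
      hc := by positivity
      da := fun i w hw => (differentiableAt_id.fun_mul (hp i w hw).2.2).fun_inv
        (mul_pos hw (hp i w hw).2.1).ne'
      db := fun j w hw => (differentiableAt_id.fun_mul (hq j w hw).2.2).fun_inv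
        (mul_pos hw (hq j w hw).2.1).ne'
      pa := hpa
      pb := hpb
      ea := fun i w hw => by
        have e := (h3 _ (hoff w hw)).1 i
        rw [(hp i w hw).1] at e
        refine aux w (p i w) _ _ hw ?_ e
        rw [hTt w hw]
        simp [Matrix.trace, Matrix.diagonal_mul]
      eb := fun j w hw => by
        have e := (h3 _ (hoff w hw)).2 j
        rw [(hq j w hw).1] at e
        refine aux w (q j w) _ _ hw ?_ e
        rw [hT w hw]
        simp [Matrix.trace, Matrix.diagonal_mul] }
  have hNr : (N : ℝ) ≠ 0 := by exact_mod_cast hN.ne'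
  have hint : ∫ ω in Set.Ioi s2,
      (ω⁻¹ - (N : ℝ)⁻¹ * ((Tmat A ψ ψt (-(ω : ℂ))).trace).re)
      = (N : ℝ)⁻¹ * VR A (fun i j => σ i j ^ 2) (n : ℝ)⁻¹ a b s2 := by
    rw [← hsys.integral_eq s2 hs2, ← integral_const_mul]
    refine setIntegral_congr_fun measurableSet_Ioi fun w hw => ?_
    have hw0 : 0 < w := hs2.trans hw
    simp only [hT w hw0, Fintype.card_fin]
    have : (((KR A w (fun i => a i w) (fun j => b j w))⁻¹).map Complex.ofReal).trace.re
        = ((KR A w (fun i => a i w) (fun j => b j w))⁻¹).trace := by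
      simp [Matrix.trace]
    rw [this]
    field_simp
  have hdpos := (KR_posDef A s2 _ _ hs2 (fun i => hpa i s2 hs2) (fun j => hpb j s2 hs2)).det_pos
  have hd1 : Matrix.det ((s2 : ℂ)⁻¹ • (Matrix.diagonal fun i => ψ i (-(s2 : ℂ)))⁻¹
            + A.map Complex.ofReal * Matrix.diagonal (fun j => ψt j (-(s2 : ℂ)))
              * (A.map Complex.ofReal)ᵀ)
      = ((s2⁻¹ ^ N * (KR A s2 (fun i => a i s2) (fun j => b j s2)).det : ℝ) : ℂ) := by
    have hs2c : (s2 : ℂ) ≠ 0 := by exact_mod_cast hs2.ne'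
    have e := inner_eq A (fun i => ψ i (-(s2 : ℂ))) (fun j => ψt j (-(s2 : ℂ))) s2 hs2
      (fun i => p i s2) (fun j => q j s2) (fun i => (hp i s2 hs2).1)
      (fun j => (hq j s2 hs2).1) (fun i => (hp i s2 hs2).2.1)
    have e2 := congrArg (fun M => (s2 : ℂ)⁻¹ • M) e
    simp only [smul_add, smul_smul, inv_mul_cancel₀ hs2c, one_smul] at e2
    rw [e2, Matrix.det_smul, Fintype.card_fin]
    have e3 := (RingHom.map_det Complex.ofRealHom (KR A s2 (fun i => a i s2) (fun j => b j s2)))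
    push_cast
    congr 1
    exact e3.symm
  have hd2 : Matrix.det ((s2 : ℂ)⁻¹ • (Matrix.diagonal fun j => ψt j (-(s2 : ℂ)))⁻¹)
      = ((∏ j, b j s2 : ℝ) : ℂ) := by
    rw [diag_inv _ (fun j => by rw [(hq j s2 hs2).1]; exact_mod_cast (hq j s2 hs2).2.1.ne'),
      ← Matrix.diagonal_smul, Matrix.det_diagonal, Complex.ofReal_prod]
    refine Finset.prod_congr rfl fun j _ => ?_
    rw [Pi.smul_apply, (hq j s2 hs2).1, hb]
    simp [mul_comm]
  rw [hint, hd1, hd2, hT s2 hs2, hTt s2 hs2, ← Complex.ofReal_log, ← Complex.ofReal_log,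
    Real.log_mul (pow_pos (inv_pos.2 hs2) _).ne' hdpos.ne', Real.log_pow, Real.log_inv,
    Real.log_prod (fun j _ => (hpb j s2 hs2).ne')]
  · simp only [VR, Matrix.map_apply, Fintype.card_fin]
    push_cast
    rw [div_eq_mul_inv, mul_inv]
    ring
  · exact Finset.prod_nonneg fun j _ => (hpb j s2 hs2).le
  · exact (mul_pos (pow_pos (inv_pos.2 hs2) _) hdpos).le
end
end
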